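/- arXiv:1910.06231 — 3 statements merged into one kernel-verified Lean document; each statement's English description precedes it below -/
import Mathlib

section
/- Let A be a set of n lines in ℝ² in general position, let r₁, r₂, r₃ be positive integers with r₁ + r₂ + r₃ = r, and set M_i = ⌈(2n/3)^{r_i/r}⌉ − 2 for i = 1, 2, 3. If (C₁, C₂, C₃) is a convex partition of ℝ² into three parts with μ_A(C₁) ≤ M₁ + 1 and μ_A(C₂) ≤ M₂ + 1, then μ_A(C₃) ≥ M₃. -/
open scoped Classical

/-- A line in the plane: the solution set of `a*x + b*y = c` with `(a,b) ≠ (0,0)`. -/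
def IsLine (L : Set (ℝ × ℝ)) : Prop :=
  ∃ a b c : ℝ, (a, b) ≠ (0, 0) ∧ L = {p : ℝ × ℝ | a * p.1 + b * p.2 = c}

/-- The incidence set of a finite family of lines: all pairwise intersection points. -/
def incSet (L : Finset (Set (ℝ × ℝ))) : Set (ℝ × ℝ) :=
  {p | ∃ ℓ₁ ∈ L, ∃ ℓ₂ ∈ L, ℓ₁ ≠ ℓ₂ ∧ p ∈ ℓ₁ ∧ p ∈ ℓ₂}

/-- Two lines are non-parallel if they meet in exactly one point. -/
def NotParallel (L₁ L₂ : Set (ℝ × ℝ)) : Prop := ∃! p : ℝ × ℝ, p ∈ L₁ ∩ L₂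

/-- No two lines of the family are parallel. -/
def PairwiseNonParallel (L : Finset (Set (ℝ × ℝ))) : Prop :=
  ∀ ℓ₁ ∈ L, ∀ ℓ₂ ∈ L, ℓ₁ ≠ ℓ₂ → NotParallel ℓ₁ ℓ₂

/-- A family of lines is in general position: no two parallel, no three concurrent, and any
three collinear points of the incidence set lie on a common line of the family. -/
def GenPos (L : Finset (Set (ℝ × ℝ))) : Prop :=
  PairwiseNonParallel L ∧
  (∀ ℓ₁ ∈ L, ∀ ℓ₂ ∈ L, ∀ ℓ₃ ∈ L, ℓ₁ ≠ ℓ₂ → ℓ₁ ≠ ℓ₃ → ℓ₂ ≠ ℓ₃ →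
    ¬ ∃ p : ℝ × ℝ, p ∈ ℓ₁ ∧ p ∈ ℓ₂ ∧ p ∈ ℓ₃) ∧
  (∀ p q s : ℝ × ℝ, p ∈ incSet L → q ∈ incSet L → s ∈ incSet L →
    p ≠ q → p ≠ s → q ≠ s → Collinear ℝ ({p, q, s} : Set (ℝ × ℝ)) →
    ∃ ℓ ∈ L, p ∈ ℓ ∧ q ∈ ℓ ∧ s ∈ ℓ)

/-- `mu A K` is the largest cardinality of a subset of `A` whose incidence set lies in `K`. -/
noncomputable def mu (A : Finset (Set (ℝ × ℝ))) (K : Set (ℝ × ℝ)) : ℕ :=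
  (A.powerset.filter (fun A' => incSet A' ⊆ K)).sup Finset.card

/-- A convex partition of the plane into `r` parts: closed convex sets covering `ℝ²`
with pairwise disjoint interiors. -/
def ConvexPartition {r : ℕ} (C : Fin r → Set (ℝ × ℝ)) : Prop :=
  (∀ j, IsClosed (C j)) ∧ (∀ j, Convex ℝ (C j)) ∧
  (⋃ j, C j) = Set.univ ∧
  Pairwise fun i j => interior (C i) ∩ interior (C j) = ∅

/-- A finite strict partial order whose chains have at most `m` elements can be coloured with
`m` colours so that comparable elements get different colours. -/
theorem exists_antichain_coloring {α : Type*} (B : Finset α) (r : α → α → Prop) (m : ℕ)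
    (irrefl : ∀ a ∈ B, ¬ r a a)
    (trans : ∀ a ∈ B, ∀ b ∈ B, ∀ c ∈ B, r a b → r b c → r a c)
    (chain_card : ∀ S ⊆ B, (∀ a ∈ S, ∀ b ∈ S, a ≠ b → r a b ∨ r b a) → S.card ≤ m) :
    ∃ c : α → ℕ, (∀ a ∈ B, c a < m) ∧ ∀ a ∈ B, ∀ b ∈ B, r a b → c a ≠ c b := by
  let F : α → Finset (Finset α) := fun a => B.powerset.filter fun S =>
    (∀ x ∈ S, ∀ y ∈ S, x ≠ y → r x y ∨ r y x) ∧ ∀ x ∈ S, r x a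
  have key : ∀ a ∈ B, ∃ S ⊆ B, a ∈ S ∧ S.card = (F a).sup Finset.card + 1 ∧
      (∀ x ∈ S, ∀ y ∈ S, x ≠ y → r x y ∨ r y x) ∧ ∀ x ∈ S, x = a ∨ r x a := by
    intro a ha
    have hne : (F a).Nonempty := ⟨∅, by simp [F]⟩
    obtain ⟨S, hS, hcard⟩ := Finset.exists_mem_eq_sup (F a) hne Finset.card
    simp only [F, Finset.mem_filter, Finset.mem_powerset] at hS
    obtain ⟨hSB, hch, htop⟩ := hS
    have haS : a ∉ S := fun h => irrefl a ha (htop a h)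
    refine ⟨insert a S, Finset.insert_subset ha hSB, Finset.mem_insert_self _ _, ?_, ?_, ?_⟩
    · rw [Finset.card_insert_of_notMem haS, hcard]
    · intro x hx y hy hxy
      rcases Finset.mem_insert.1 hx with hxa | hxS <;>
        rcases Finset.mem_insert.1 hy with hya | hyS
      · exact absurd (hxa.trans hya.symm) hxy
      · exact Or.inr (hxa ▸ htop y hyS)
      · exact Or.inl (hya ▸ htop x hxS)
      · exact hch x hxS y hyS hxy
    · intro x hx
      exact (Finset.mem_insert.1 hx).imp id (htop x)
  refine ⟨fun a => (F a).sup Finset.card, fun a ha => ?_, fun a ha b hb hab => ?_⟩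
  · obtain ⟨S, hSB, -, hcard, hch, -⟩ := key a ha
    have := chain_card S hSB hch
    simp only
    omega
  · obtain ⟨S, hSB, -, hcard, hch, htop⟩ := key a ha
    have hmem : S ∈ F b := by
      simp only [F, Finset.mem_filter, Finset.mem_powerset]
      refine ⟨hSB, hch, fun x hx => ?_⟩
      rcases htop x hx with rfl | hxa
      · exact hab
      · exact trans x (hSB hx) a ha b hb hxa hab
    have := Finset.le_sup (f := Finset.card) hmem
    simp only
    omega

theorem card_le_mu {A S : Finset (Set (ℝ × ℝ))} {K : Set (ℝ × ℝ)} (hS : S ⊆ A)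
    (hK : incSet S ⊆ K) : S.card ≤ mu A K :=
  Finset.le_sup (f := Finset.card) (by simp [hS, hK])

theorem one_le_mu {A : Finset (Set (ℝ × ℝ))} (hA : A.Nonempty) (K : Set (ℝ × ℝ)) :
    1 ≤ mu A K := by
  obtain ⟨ℓ, hℓ⟩ := hA
  refine card_le_mu (S := {ℓ}) (by simpa using hℓ) ?_
  rintro p ⟨a, ha, b, hb, hab, -⟩
  simp only [Finset.mem_singleton] at ha hb
  exact absurd (ha.trans hb.symm) hab

theorem IsLine.convex {ℓ : Set (ℝ × ℝ)} (h : IsLine ℓ) : Convex ℝ ℓ := by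
  obtain ⟨a, b, c, -, rfl⟩ := h
  intro p hp q hq s t _ _ hst
  simp only [Set.mem_ofPred_eq, Prod.fst_add, Prod.snd_add, Prod.smul_fst, Prod.smul_snd,
    smul_eq_mul] at *
  linear_combination s * hp + t * hq + c * hst

theorem IsLine.add_smul_mem {ℓ : Set (ℝ × ℝ)} (h : IsLine ℓ) {p q : ℝ × ℝ} (hp : p ∈ ℓ)
    (hq : q ∈ ℓ) (s : ℝ) : p + s • (q - p) ∈ ℓ := by
  obtain ⟨a, b, c, -, rfl⟩ := h
  simp only [Set.mem_ofPred_eq, Prod.fst_add, Prod.snd_add, Prod.smul_fst, Prod.smul_snd,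
    Prod.fst_sub, Prod.snd_sub, smul_eq_mul] at *
  linear_combination (1 - s) * hp + s * hq

theorem IsLine.exists_eq_add_smul {ℓ : Set (ℝ × ℝ)} (h : IsLine ℓ) {p q y : ℝ × ℝ}
    (hp : p ∈ ℓ) (hq : q ∈ ℓ) (hpq : p ≠ q) (hy : y ∈ ℓ) : ∃ s : ℝ, y = p + s • (q - p) := by
  obtain ⟨a, b, c, hab, rfl⟩ := h
  simp only [Set.mem_ofPred_eq] at hp hq hy
  have hpos : 0 < (q.1 - p.1) ^ 2 + (q.2 - p.2) ^ 2 := by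
    by_contra! hle
    apply hpq
    ext <;> nlinarith [sq_nonneg (q.1 - p.1), sq_nonneg (q.2 - p.2)]
  have hcross : (y.1 - p.1) * (q.2 - p.2) = (y.2 - p.2) * (q.1 - p.1) := by
    by_contra hne
    apply hab
    have hne' := sub_ne_zero.2 hne
    have ha : a = 0 := by
      apply (mul_eq_zero.1 _).resolve_right hne'
      linear_combination (q.2 - p.2) * (hy - hp) - (y.2 - p.2) * (hq - hp)
    have hb : b = 0 := by
      apply (mul_eq_zero.1 _).resolve_right hne'
      linear_combination (y.1 - p.1) * (hq - hp) - (q.1 - p.1) * (hy - hp)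
    rw [ha, hb]
  refine ⟨((y.1 - p.1) * (q.1 - p.1) + (y.2 - p.2) * (q.2 - p.2)) /
    ((q.1 - p.1) ^ 2 + (q.2 - p.2) ^ 2), ?_⟩
  ext
  · simp only [Prod.fst_add, Prod.smul_fst, Prod.fst_sub, smul_eq_mul]
    field_simp
    linear_combination (q.2 - p.2) * hcross
  · simp only [Prod.snd_add, Prod.smul_snd, Prod.snd_sub, smul_eq_mul]
    field_simp
    linear_combination -(q.1 - p.1) * hcross

/-- Relative to a nonzero functional `u`, every line is either a level set of `u` or the graph of
an affine function of `u`. -/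
theorem IsLine.graph_or_level {ℓ : Set (ℝ × ℝ)} (h : IsLine ℓ) {u : ℝ × ℝ →L[ℝ] ℝ}
    (hu : u ≠ 0) :
    (∃ m k : ℝ, ℓ = {p | u (1, 0) * p.2 - u (0, 1) * p.1 = m * u p + k}) ∨
      ∃ c : ℝ, ℓ = {p | u p = c} := by
  obtain ⟨a, b, c, hab, rfl⟩ := h
  have hup : ∀ p : ℝ × ℝ, u p = u (1, 0) * p.1 + u (0, 1) * p.2 := by
    intro p
    have hp : p = p.1 • ((1, 0) : ℝ × ℝ) + p.2 • ((0, 1) : ℝ × ℝ) := by ext <;> simp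
    conv_lhs => rw [hp]
    simp only [map_add, map_smul, smul_eq_mul]
    ring
  obtain ⟨α, hα⟩ : ∃ α, u (1, 0) = α := ⟨_, rfl⟩
  obtain ⟨β, hβ⟩ : ∃ β, u (0, 1) = β := ⟨_, rfl⟩
  rw [hα, hβ]
  simp only [hα, hβ] at hup
  simp only [hup]
  have hpos : 0 < α ^ 2 + β ^ 2 := by
    by_contra! hle
    apply hu
    have h1 : α = 0 := by nlinarith [sq_nonneg α, sq_nonneg β]
    have h2 : β = 0 := by nlinarith [sq_nonneg α, sq_nonneg β]
    ext <;> simp [hα, hβ, h1, h2]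
  by_cases ht : b * α - a * β = 0
  · right
    have hs : a * α + b * β ≠ 0 := by
      intro hs
      apply hab
      have ha : a = 0 := by
        apply (mul_eq_zero.1 _).resolve_right hpos.ne'
        linear_combination α * hs - β * ht
      have hb : b = 0 := by
        apply (mul_eq_zero.1 _).resolve_right hpos.ne'
        linear_combination β * hs + α * ht
      rw [ha, hb]
    refine ⟨c * (α ^ 2 + β ^ 2) / (a * α + b * β), ?_⟩
    ext p
    simp only [Set.mem_ofPred_eq]
    rw [eq_div_iff hs]
    constructor
    · intro hp
      linear_combination (α ^ 2 + β ^ 2) * hp - (α * p.2 - β * p.1) * ht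
    · intro hp
      apply mul_right_cancel₀ hpos.ne'
      linear_combination hp + (α * p.2 - β * p.1) * ht
  · left
    refine ⟨-(a * α + b * β) / (b * α - a * β), c * (α ^ 2 + β ^ 2) / (b * α - a * β), ?_⟩
    ext p
    simp only [Set.mem_ofPred_eq]
    rw [div_mul_eq_mul_div, ← add_div, eq_div_iff ht]
    constructor
    · intro hp
      linear_combination (α ^ 2 + β ^ 2) * hp
    · intro hp
      apply mul_right_cancel₀ hpos.ne'
      linear_combination hp

/-- In a family without parallel lines, at most one line is a level set of `u`. -/
theorem card_le_card_filter_not_level_add_one {A B : Finset (Set (ℝ × ℝ))}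
    (hA : PairwiseNonParallel A) (hBA : B ⊆ A) (u : ℝ × ℝ →L[ℝ] ℝ) :
    B.card ≤ (B.filter fun ℓ => ¬ ∃ c : ℝ, ℓ = {p | u p = c}).card + 1 := by
  have hone : (B.filter fun ℓ => ∃ c : ℝ, ℓ = {p | u p = c}).card ≤ 1 := by
    rw [Finset.card_le_one]
    intro a ha b hb
    by_contra hab
    rw [Finset.mem_filter] at ha hb
    obtain ⟨ha, c, hc⟩ := ha
    obtain ⟨hb, d, hd⟩ := hb
    obtain ⟨p, ⟨hpa, hpb⟩, -⟩ := hA a (hBA ha) b (hBA hb) hab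
    rw [hc] at hpa
    rw [hd] at hpb
    apply hab
    rw [hc, hd, ← hpa.out, ← hpb.out]
  rw [← Finset.card_filter_add_card_filter_not (s := B) fun ℓ => ∃ c : ℝ, ℓ = {p | u p = c},
    add_comm]
  exact Nat.add_le_add_left hone _

/-- If every line of `B` is transversal to the level sets of `u` and can only leave `K`, in the
direction in which `u` grows, above all the values of `u` on `K`, then being crossing inside `K`
is comparability in a partial order, so `B` splits into at most `mu A K` subfamilies without
crossings inside `K`. -/
theorem exists_coloring_of_upward {A B : Finset (Set (ℝ × ℝ))} (hBA : B ⊆ A)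
    (hA : PairwiseNonParallel A) {u : ℝ × ℝ →L[ℝ] ℝ} {K : Set (ℝ × ℝ)}
    (graph : ∀ ℓ ∈ B, ∃ m k : ℝ, ℓ = {p | u (1, 0) * p.2 - u (0, 1) * p.1 = m * u p + k})
    (upward : ∀ ℓ ∈ B, ∀ p ∈ ℓ, p ∈ K → ∀ q ∈ ℓ, u p ≤ u q → (∃ z ∈ K, u q ≤ u z) → q ∈ K) :
    ∃ c : Set (ℝ × ℝ) → ℕ, (∀ a ∈ B, c a < mu A K) ∧
      ∀ a ∈ B, ∀ b ∈ B, a ≠ b → c a = c b → ∀ p ∈ a, p ∈ b → p ∉ K := by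
  choose! m k hmk using graph
  have eqn : ∀ a ∈ B, ∀ p ∈ a, u (1, 0) * p.2 - u (0, 1) * p.1 = m a * u p + k a := by
    intro a ha p hp
    rw [hmk a ha] at hp
    exact hp
  have slope_ne : ∀ a ∈ B, ∀ b ∈ B, a ≠ b → ∀ p ∈ a, p ∈ b → m a ≠ m b := by
    intro a ha b hb hab p hpa hpb hm
    have h1 := eqn a ha p hpa
    have h2 := eqn b hb p hpb
    have hk : k a = k b := by rw [hm] at h1; linarith
    apply hab
    rw [hmk a ha, hmk b hb, hm, hk]
  let r : Set (ℝ × ℝ) → Set (ℝ × ℝ) → Prop := fun a b => m a < m b ∧ ∃ p ∈ a, p ∈ b ∧ p ∈ K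
  have trans : ∀ a ∈ B, ∀ b ∈ B, ∀ d ∈ B, r a b → r b d → r a d := by
    rintro a ha b hb d hd ⟨hab, p, hpa, hpb, hpK⟩ ⟨hbd, q, hqb, hqd, hqK⟩
    have had : a ≠ d := by
      rintro rfl
      linarith
    obtain ⟨s, ⟨hsa, hsd⟩, -⟩ := hA a (hBA ha) d (hBA hd) had
    refine ⟨hab.trans hbd, s, hsa, hsd, ?_⟩
    have e1 := eqn a ha p hpa
    have e2 := eqn b hb p hpb
    have e3 := eqn b hb q hqb
    have e4 := eqn d hd q hqd
    have e5 := eqn a ha s hsa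
    have e6 := eqn d hd s hsd
    have avg : (m d - m b) * (u s - u q) + (m b - m a) * (u s - u p) = 0 := by
      linear_combination e5 - e6 - e1 + e2 - e3 + e4
    rcases le_total (u p) (u s) with h | h
    · refine upward a ha p hpa hpK s hsa h ⟨q, hqK, ?_⟩
      nlinarith
    · refine upward d hd q hqd hqK s hsd ?_ ⟨p, hpK, h⟩
      nlinarith
  have chain_card : ∀ S ⊆ B, (∀ a ∈ S, ∀ b ∈ S, a ≠ b → r a b ∨ r b a) → S.card ≤ mu A K := by
    intro S hS hch
    refine card_le_mu (hS.trans hBA) ?_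
    rintro p ⟨a, ha, b, hb, hab, hpa, hpb⟩
    have huniq := hA a (hBA (hS ha)) b (hBA (hS hb)) hab
    rcases hch a ha b hb hab with ⟨-, q, hqa, hqb, hqK⟩ | ⟨-, q, hqb, hqa, hqK⟩ <;>
    · rwa [huniq.unique ⟨hpa, hpb⟩ ⟨hqa, hqb⟩]
  obtain ⟨c, hc, hcr⟩ := exists_antichain_coloring B r (mu A K)
    (fun a _ h => lt_irrefl _ h.1) trans chain_card
  refine ⟨c, hc, fun a ha b hb hab hcab p hpa hpb hpK => ?_⟩
  rcases (slope_ne a ha b hb hab p hpa hpb).lt_or_gt with h | h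
  · exact hcr a ha b hb ⟨h, p, hpa, hpb, hpK⟩ hcab
  · exact hcr b hb a ha ⟨h, p, hpb, hpa, hpK⟩ hcab.symm

theorem mu_mono (A : Finset (Set (ℝ × ℝ))) {K K' : Set (ℝ × ℝ)} (h : K ⊆ K') :
    mu A K ≤ mu A K' := by
  refine Finset.sup_le fun S hS => ?_
  rw [Finset.mem_filter, Finset.mem_powerset] at hS
  exact card_le_mu hS.1 (hS.2.trans h)

/-- A functional that takes the same value at two points of a line is constant on the line. -/
theorem IsLine.level_of_eq {ℓ : Set (ℝ × ℝ)} (h : IsLine ℓ) {u : ℝ × ℝ →L[ℝ] ℝ} (hu : u ≠ 0)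
    {p q : ℝ × ℝ} (hp : p ∈ ℓ) (hq : q ∈ ℓ) (hpq : p ≠ q) (hupq : u p = u q) :
    ∃ c : ℝ, ℓ = {x | u x = c} := by
  refine (h.graph_or_level hu).resolve_left ?_
  rintro ⟨m, k, rfl⟩
  simp only [Set.mem_ofPred_eq, hupq] at hp hq
  have hd : u (q - p) = 0 := by rw [map_sub, hupq, sub_self]
  have hdec : q - p = (q - p).1 • ((1, 0) : ℝ × ℝ) + (q - p).2 • ((0, 1) : ℝ × ℝ) := by
    ext <;> simp
  rw [hdec] at hd
  simp only [map_add, map_smul, smul_eq_mul, Prod.fst_sub, Prod.snd_sub] at hd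
  have e1 := hq.trans hp.symm
  have hpos : 0 < (q.1 - p.1) ^ 2 + (q.2 - p.2) ^ 2 := by
    by_contra! hle
    apply hpq
    ext <;> nlinarith [sq_nonneg (q.1 - p.1), sq_nonneg (q.2 - p.2)]
  have hα : u (1, 0) = 0 := by
    apply (mul_eq_zero.1 _).resolve_right hpos.ne'
    linear_combination (q.1 - p.1) * hd + (q.2 - p.2) * e1
  have hβ : u (0, 1) = 0 := by
    apply (mul_eq_zero.1 _).resolve_right hpos.ne'
    linear_combination (q.2 - p.2) * hd - (q.1 - p.1) * e1
  apply hu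
  ext <;> simp [hα, hβ]

theorem exists_separation {X Y : Set (ℝ × ℝ)} (hX : IsClosed X) (hXc : Convex ℝ X)
    (hXi : (interior X).Nonempty) (hY : IsClosed Y) (hYc : Convex ℝ Y)
    (hYi : (interior Y).Nonempty) (hXY : interior X ∩ interior Y = ∅) :
    ∃ (φ : ℝ × ℝ →L[ℝ] ℝ) (c : ℝ), φ ≠ 0 ∧ (∀ x ∈ X, φ x ≤ c) ∧ (∀ y ∈ Y, c ≤ φ y) ∧
      (∀ x ∈ interior X, φ x < c) ∧ ∀ y ∈ interior Y, c < φ y := by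
  obtain ⟨φ, c, h1, h2⟩ := geometric_hahn_banach_open_open hXc.interior isOpen_interior
    hYc.interior isOpen_interior (Set.disjoint_iff_inter_eq_empty.2 hXY)
  refine ⟨φ, c, ?_, ?_, ?_, h1, h2⟩
  · rintro rfl
    obtain ⟨x, hx⟩ := hXi
    obtain ⟨y, hy⟩ := hYi
    have := h1 x hx
    have := h2 y hy
    simp at *
    linarith
  · rw [← hX.closure_eq, ← hXc.closure_interior_eq_closure_of_nonempty_interior hXi]
    exact closure_minimal (t := {x | φ x ≤ c}) (fun x hx => (h1 x hx).le)
      (isClosed_le φ.continuous continuous_const)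
  · rw [← hY.closure_eq, ← hYc.closure_interior_eq_closure_of_nonempty_interior hYi]
    exact closure_minimal (t := {x | c ≤ φ x}) (fun x hx => (h2 x hx).le)
      (isClosed_le continuous_const φ.continuous)

/-- If all crossings between lines of `B` that get the same colour under both `c₁` and `c₂` lie
in `K`, then each common colour class has at most `mu A K` lines. -/
theorem card_le_mul_mul_mu {A B : Finset (Set (ℝ × ℝ))} (hBA : B ⊆ A) {m₁ m₂ : ℕ}
    {c₁ c₂ : Set (ℝ × ℝ) → ℕ} (hc₁ : ∀ a ∈ B, c₁ a < m₁) (hc₂ : ∀ a ∈ B, c₂ a < m₂)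
    {K : Set (ℝ × ℝ)}
    (hK : ∀ a ∈ B, ∀ b ∈ B, a ≠ b → c₁ a = c₁ b → c₂ a = c₂ b → ∀ p ∈ a, p ∈ b → p ∈ K) :
    B.card ≤ m₁ * m₂ * mu A K := by
  have := Finset.card_le_mul_card_image_of_maps_to (f := fun a => (c₁ a, c₂ a)) (s := B)
    (t := Finset.range m₁ ×ˢ Finset.range m₂)
    (fun a ha => Finset.mem_product.2
      ⟨Finset.mem_range.2 (hc₁ a ha), Finset.mem_range.2 (hc₂ a ha)⟩) (mu A K) ?_
  · rwa [Finset.card_product, Finset.card_range, Finset.card_range, mul_comm] at this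
  · intro x _
    refine card_le_mu ((Finset.filter_subset _ _).trans hBA) ?_
    rintro p ⟨a, ha, b, hb, hab, hpa, hpb⟩
    rw [Finset.mem_filter] at ha hb
    have e := Prod.mk.inj (ha.2.trans hb.2.symm)
    exact hK a ha.1 b hb.1 hab e.1 e.2 p hpa hpb

set_option maxHeartbeats 1000000 in
/-- For a convex partition into `K₁`, `K₂`, `K₃`, the lines that meet `K₂ ∩ K₃` or miss
`K₁ ∩ K₂` number at most the product of the three values of `mu` plus two. -/
theorem card_filter_walls_le {A : Finset (Set (ℝ × ℝ))} (hlines : ∀ ℓ ∈ A, IsLine ℓ)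
    (hA : PairwiseNonParallel A) {K₁ K₂ K₃ : Set (ℝ × ℝ)}
    (cl₁ : IsClosed K₁) (cl₂ : IsClosed K₂) (cl₃ : IsClosed K₃)
    (cv₁ : Convex ℝ K₁) (cv₂ : Convex ℝ K₂) (cv₃ : Convex ℝ K₃)
    (ne₁ : (interior K₁).Nonempty) (ne₂ : (interior K₂).Nonempty) (ne₃ : (interior K₃).Nonempty)
    (d₁₂ : interior K₁ ∩ interior K₂ = ∅) (d₂₃ : interior K₂ ∩ interior K₃ = ∅)
    (d₃₁ : interior K₃ ∩ interior K₁ = ∅) (cover : ∀ p, p ∈ K₁ ∨ p ∈ K₂ ∨ p ∈ K₃) :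
    (A.filter fun ℓ => (ℓ ∩ (K₁ ∩ K₂)).Nonempty → (ℓ ∩ (K₂ ∩ K₃)).Nonempty).card ≤
      mu A K₁ * mu A K₂ * mu A K₃ + 2 := by
  obtain ⟨f, cf, hf, f1, f2, f1', f2'⟩ := exists_separation cl₁ cv₁ ne₁ cl₂ cv₂ ne₂ d₁₂
  obtain ⟨g, cg, hg, g2, g3, -, -⟩ := exists_separation cl₂ cv₂ ne₂ cl₃ cv₃ ne₃ d₂₃
  obtain ⟨h, ch, hh, h3, h1, h3', h1'⟩ := exists_separation cl₃ cv₃ ne₃ cl₁ cv₁ ne₁ d₃₁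
  have mem₁ : ∀ p, f p ≤ cf → ch ≤ h p → p ∈ K₁ := by
    intro p hfp hhp
    obtain ⟨x, hx⟩ := ne₁
    have hsub : openSegment ℝ x p ⊆ K₁ := by
      rintro z ⟨a, b, ha, hb, hab, rfl⟩
      have hfx := f1' x hx
      have hhx := h1' x hx
      rcases cover (a • x + b • p) with hz | hz | hz
      · exact hz
      · have := f2 _ hz
        simp only [map_add, map_smul, smul_eq_mul] at this
        obtain rfl : b = 1 - a := by linarith
        nlinarith
      · have := h3 _ hz
        simp only [map_add, map_smul, smul_eq_mul] at this
        obtain rfl : b = 1 - a := by linarith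
        nlinarith
    rw [← cl₁.closure_eq]
    exact closure_mono hsub (segment_subset_closure_openSegment (right_mem_segment ℝ x p))
  obtain ⟨t, ht, hu⟩ : ∃ t : ℝ, 0 < t ∧ h - t • f ≠ 0 := by
    by_contra! hcon
    have e1 := hcon 1 one_pos
    have e2 := hcon 2 two_pos
    apply hf
    have : f = (h - (1 : ℝ) • f) - (h - (2 : ℝ) • f) := by module
    rw [this, e1, e2, sub_zero]
  have hu_apply : ∀ p, (h - t • f) p = h p - t * f p := fun p => by simp
  set kept := A.filter fun ℓ => (ℓ ∩ (K₁ ∩ K₂)).Nonempty → (ℓ ∩ (K₂ ∩ K₃)).Nonempty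
  have hkeptA : kept ⊆ A := Finset.filter_subset _ _
  set B := (kept.filter fun ℓ => ¬ ∃ c : ℝ, ℓ = {p | g p = c}).filter fun ℓ =>
    ¬ ∃ c : ℝ, ℓ = {p | (h - t • f) p = c}
  have hBA : B ⊆ A := (Finset.filter_subset _ _).trans ((Finset.filter_subset _ _).trans hkeptA)
  have hBg : ∀ ℓ ∈ B, ¬ ∃ c : ℝ, ℓ = {p | g p = c} := fun ℓ hℓ =>
    (Finset.mem_filter.1 (Finset.mem_filter.1 hℓ).1).2
  have hBu : ∀ ℓ ∈ B, ¬ ∃ c : ℝ, ℓ = {p | (h - t • f) p = c} := fun ℓ hℓ =>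
    (Finset.mem_filter.1 hℓ).2
  have walls : ∀ ℓ ∈ B, (ℓ ∩ (K₁ ∩ K₂)).Nonempty → (ℓ ∩ (K₂ ∩ K₃)).Nonempty := fun ℓ hℓ =>
    (Finset.mem_filter.1 (Finset.mem_filter.1 (Finset.mem_filter.1 hℓ).1).1).2
  have triple : ∀ ℓ ∈ B, ∀ p ∈ ℓ, p ∈ K₁ → ∀ q ∈ ℓ, f p < f q → h p < h q → p ∈ K₂ ∩ K₃ := by
    intro ℓ hℓ p hp hpK q hq hfpq hhpq
    have hline := hlines ℓ (hBA hℓ)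
    have hfs : ∀ s : ℝ, f (p + s • (q - p)) = f p + s * (f q - f p) := fun s => by simp
    have hhs : ∀ s : ℝ, h (p + s • (q - p)) = h p + s * (h q - h p) := fun s => by simp
    have hray : IsPreconnected ((fun s : ℝ => p + s • (q - p)) '' Set.Ici 0) :=
      isPreconnected_Ici.image _ (by fun_prop)
    have hsub : (fun s : ℝ => p + s • (q - p)) '' Set.Ici 0 ⊆ K₁ ∪ K₂ := by
      rintro _ ⟨s, hs, rfl⟩
      rcases (Set.mem_Ici.1 hs).eq_or_lt with rfl | hs
      · simpa using Or.inl hpK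
      · rcases cover (p + s • (q - p)) with hz | hz | hz
        · exact Or.inl hz
        · exact Or.inr hz
        · have e1 := h3 _ hz
          rw [hhs] at e1
          have e2 := h1 p hpK
          nlinarith
    have hmeet : ((fun s : ℝ => p + s • (q - p)) '' Set.Ici 0 ∩ K₂).Nonempty := by
      have hs : 0 ≤ (cf - f p) / (f q - f p) :=
        div_nonneg (sub_nonneg.2 (f1 p hpK)) (sub_pos.2 hfpq).le
      have hmem := Set.mem_image_of_mem (fun s : ℝ => p + s • (q - p))
        (Set.mem_Ici.2 (add_nonneg hs zero_le_one))
      refine ⟨_, hmem, (hsub hmem).resolve_left fun hz => ?_⟩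
      have e1 := f1 _ hz
      rw [hfs, add_mul, div_mul_cancel₀ _ (sub_pos.2 hfpq).ne'] at e1
      linarith
    obtain ⟨w, ⟨s, -, rfl⟩, hw⟩ := isPreconnected_closed_iff.1 hray K₁ K₂ cl₁ cl₂ hsub
      ⟨p, ⟨0, by simp, by simp⟩, hpK⟩ hmeet
    obtain ⟨y, hyℓ, hy2, hy3⟩ := walls ℓ hℓ ⟨_, hline.add_smul_mem hp hq s, hw⟩
    obtain ⟨v, rfl⟩ := hline.exists_eq_add_smul hp hq (by rintro rfl; exact hfpq.false) hyℓ
    have e1 := f2 _ hy2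
    have e2 := h3 _ hy3
    rw [hfs] at e1
    rw [hhs] at e2
    have e3 := f1 p hpK
    have e4 := h1 p hpK
    have hv : v = 0 := by
      apply le_antisymm
      · by_contra! hv
        nlinarith
      · by_contra! hv
        nlinarith
    subst hv
    rw [zero_smul, add_zero] at hy2 hy3
    exact ⟨hy2, hy3⟩
  obtain ⟨c₁, hc₁, hcr₁⟩ := exists_coloring_of_upward hBA hA (u := h - t • f)
    (K := K₁ \ (K₂ ∩ K₃))
    (fun ℓ hℓ => ((hlines ℓ (hBA hℓ)).graph_or_level hu).resolve_right (hBu ℓ hℓ)) (by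
    rintro ℓ hℓ p hp ⟨hp1, hpZ⟩ q hq hpq -
    have hline := hlines ℓ (hBA hℓ)
    by_cases hne : p = q
    · rw [← hne]
      exact ⟨hp1, hpZ⟩
    have hlt := lt_of_le_of_ne hpq fun e => (hBu ℓ hℓ) (hline.level_of_eq hu hp hq hne e)
    rw [hu_apply, hu_apply] at hlt
    have e1 := f1 p hp1
    have e2 := h1 p hp1
    refine ⟨?_, ?_⟩
    · rcases lt_or_ge (f p) (f q) with hfpq | hfpq
      · exact absurd (triple ℓ hℓ p hp hp1 q hq hfpq (by nlinarith)) hpZ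
      · rcases lt_or_ge (h q) (h p) with hhpq | hhpq
        · refine absurd (triple ℓ hℓ p hp hp1 _ (hline.add_smul_mem hp hq (-1)) ?_ ?_) hpZ
          · simp only [map_add, map_smul, map_sub, smul_eq_mul]
            nlinarith
          · simp only [map_add, map_smul, map_sub, smul_eq_mul]
            linarith
        · exact mem₁ q (by linarith) (by linarith)
    · rintro ⟨hq2, hq3⟩
      have e3 := f2 q hq2
      have e4 := h3 q hq3
      nlinarith)
  obtain ⟨c₂, hc₂, hcr₂⟩ := exists_coloring_of_upward hBA hA (u := g) (K := K₂)
    (fun ℓ hℓ => ((hlines ℓ (hBA hℓ)).graph_or_level hg).resolve_right (hBg ℓ hℓ)) (by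
    rintro ℓ hℓ p hp hp2 q hq hpq ⟨z, hz, hqz⟩
    have hline := hlines ℓ (hBA hℓ)
    by_cases hne : p = q
    · rwa [← hne]
    have hlt := lt_of_le_of_ne hpq fun e => (hBg ℓ hℓ) (hline.level_of_eq hg hp hq hne e)
    by_cases hwall : (ℓ ∩ (K₂ ∩ K₃)).Nonempty
    · obtain ⟨y, hyℓ, hy2, hy3⟩ := hwall
      obtain ⟨s, rfl⟩ := hline.exists_eq_add_smul hp hq hne hyℓ
      have e1 := g3 _ hy3
      have e2 := g2 z hz
      simp only [map_add, map_smul, map_sub, smul_eq_mul] at e1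
      have hs : 1 ≤ s := by
        by_contra! hs
        nlinarith
      have hs0 : 0 < s := by linarith
      have := cv₂.add_smul_sub_mem hp2 hy2 (t := 1 / s)
        ⟨by positivity, by rw [div_le_one hs0]; exact hs⟩
      rwa [add_sub_cancel_left, smul_smul, one_div_mul_cancel hs0.ne', one_smul,
        add_sub_cancel] at this
    · by_contra hq2
      obtain ⟨w, hwℓ, hw2, hw⟩ := isPreconnected_closed_iff.1 hline.convex.isPreconnected K₂
        (K₁ ∪ K₃) cl₂ (cl₁.union cl₃)
        (fun x _ => by rcases cover x with hx | hx | hx <;> simp [hx])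
        ⟨p, hp, hp2⟩ ⟨q, hq, by rcases cover q with hx | hx | hx <;> simp_all⟩
      rcases hw with hw | hw
      · exact hwall (walls ℓ hℓ ⟨w, hwℓ, hw, hw2⟩)
      · exact hwall ⟨w, hwℓ, hw2, hw⟩)
  have hBcard : B.card ≤ mu A (K₁ \ (K₂ ∩ K₃)) * mu A K₂ * mu A K₃ := by
    refine card_le_mul_mul_mu hBA hc₁ hc₂ fun a ha b hb hab e1 e2 p hpa hpb => ?_
    have n1 := hcr₁ a ha b hb hab e1 p hpa hpb
    have n2 := hcr₂ a ha b hb hab e2 p hpa hpb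
    rcases cover p with hp | hp | hp
    · by_contra hp3
      exact n1 ⟨hp, fun hZ => hp3 hZ.2⟩
    · exact absurd hp n2
    · exact hp
  have hcard : kept.card ≤ B.card + 1 + 1 := by
    exact (card_le_card_filter_not_level_add_one hA hkeptA g).trans (Nat.add_le_add_right
      (card_le_card_filter_not_level_add_one hA ((Finset.filter_subset _ _).trans hkeptA) _) 1)
  have hmono : mu A (K₁ \ (K₂ ∩ K₃)) * mu A K₂ * mu A K₃ ≤ mu A K₁ * mu A K₂ * mu A K₃ := by
    gcongr
    exact mu_mono A Set.sdiff_subset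
  omega

/-- The case of the main estimate in which two of the cells already cover the plane. -/
theorem card_le_of_two_cells {A : Finset (Set (ℝ × ℝ))} (hlines : ∀ ℓ ∈ A, IsLine ℓ)
    (hA : PairwiseNonParallel A) {K₁ K₂ : Set (ℝ × ℝ)} (cl₁ : IsClosed K₁) (cl₂ : IsClosed K₂)
    (cv₁ : Convex ℝ K₁) (cv₂ : Convex ℝ K₂) (d₁₂ : interior K₁ ∩ interior K₂ = ∅)
    (cover : K₁ ∪ K₂ = Set.univ) (hne : A.Nonempty) : A.card ≤ mu A K₁ * mu A K₂ + 1 := by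
  have pos₁ := one_le_mu hne K₁
  have pos₂ := one_le_mu hne K₂
  by_cases ne₁ : interior K₁ = ∅
  · have hu : K₂ = Set.univ := by
      have := interior_union_isClosed_of_interior_empty cl₂ ne₁
      rw [Set.union_comm, cover, interior_univ] at this
      exact Set.univ_subset_iff.1 (this.trans_subset interior_subset)
    have : A.card ≤ mu A K₂ := card_le_mu subset_rfl (by simp [hu])
    nlinarith
  by_cases ne₂ : interior K₂ = ∅
  · have hu : K₁ = Set.univ := by
      have := interior_union_isClosed_of_interior_empty cl₁ ne₂
      rw [cover, interior_univ] at this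
      exact Set.univ_subset_iff.1 (this.trans_subset interior_subset)
    have : A.card ≤ mu A K₁ := card_le_mu subset_rfl (by simp [hu])
    nlinarith
  rw [← ne_eq, ← Set.nonempty_iff_ne_empty] at ne₁ ne₂
  obtain ⟨f, cf, hf, f1, f2, -, -⟩ := exists_separation cl₁ cv₁ ne₁ cl₂ cv₂ ne₂ d₁₂
  have cover' : ∀ p, p ∈ K₁ ∨ p ∈ K₂ := fun p => by
    have : p ∈ K₁ ∪ K₂ := by rw [cover]; trivial
    exact this
  set B := A.filter fun ℓ => ¬ ∃ c : ℝ, ℓ = {p | f p = c}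
  have hBA : B ⊆ A := Finset.filter_subset _ _
  obtain ⟨c, hc, hcr⟩ := exists_coloring_of_upward hBA hA (u := f) (K := K₁)
    (fun ℓ hℓ => ((hlines ℓ (hBA hℓ)).graph_or_level hf).resolve_right
      (Finset.mem_filter.1 hℓ).2) (by
    rintro ℓ hℓ p hp hp1 q hq hpq ⟨z, hz, hqz⟩
    have hline := hlines ℓ (hBA hℓ)
    by_cases hne : p = q
    · rwa [← hne]
    have hlt := lt_of_le_of_ne hpq fun e =>
      (Finset.mem_filter.1 hℓ).2 (hline.level_of_eq hf hp hq hne e)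
    by_contra hq1
    obtain ⟨w, hw, hw1, hw2⟩ := isPreconnected_closed_iff.1
      (convex_segment (𝕜 := ℝ) p q).isPreconnected K₁ K₂ cl₁ cl₂ (fun x _ => cover' x)
      ⟨p, left_mem_segment ℝ p q, hp1⟩
      ⟨q, right_mem_segment ℝ p q, (cover' q).resolve_left hq1⟩
    obtain ⟨a, b, ha, hb, hab, rfl⟩ := hw
    have e1 := f2 _ hw2
    have e2 := f1 z hz
    simp only [map_add, map_smul, smul_eq_mul] at e1
    obtain rfl : b = 1 - a := by linarith
    have ha0 : a = 0 := by
      apply le_antisymm _ ha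
      by_contra! ha
      nlinarith
    rw [ha0] at hw1
    simp only [zero_smul, zero_add, sub_zero, one_smul] at hw1
    exact hq1 hw1)
  have hBcard : B.card ≤ mu A K₁ * 1 * mu A K₂ := by
    refine card_le_mul_mul_mu hBA hc (c₂ := fun _ => 0) (fun _ _ => one_pos)
      fun a ha b hb hab e1 _ p hpa hpb => ?_
    exact (cover' p).resolve_left (hcr a ha b hb hab e1 p hpa hpb)
  have : A.card ≤ B.card + 1 := card_le_card_filter_not_level_add_one hA subset_rfl f
  rw [mul_one] at hBcard
  omega

theorem two_mul_card_le {A : Finset (Set (ℝ × ℝ))} (hlines : ∀ ℓ ∈ A, IsLine ℓ)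
    (hA : PairwiseNonParallel A) (hne : A.Nonempty) {K₁ K₂ K₃ : Set (ℝ × ℝ)}
    (cl₁ : IsClosed K₁) (cl₂ : IsClosed K₂) (cl₃ : IsClosed K₃)
    (cv₁ : Convex ℝ K₁) (cv₂ : Convex ℝ K₂) (cv₃ : Convex ℝ K₃)
    (d₁₂ : interior K₁ ∩ interior K₂ = ∅) (d₂₃ : interior K₂ ∩ interior K₃ = ∅)
    (d₃₁ : interior K₃ ∩ interior K₁ = ∅) (cover : K₁ ∪ K₂ ∪ K₃ = Set.univ) :
    2 * A.card ≤ 3 * (mu A K₁ * mu A K₂ * mu A K₃ + 2) := by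
  have pos₁ := one_le_mu hne K₁
  have pos₂ := one_le_mu hne K₂
  have pos₃ := one_le_mu hne K₃
  have drop : ∀ X Y : Set (ℝ × ℝ), IsClosed X → interior Y = ∅ → X ∪ Y = Set.univ →
      X = Set.univ := by
    intro X Y hX hY hXY
    have := interior_union_isClosed_of_interior_empty hX hY
    rw [hXY, interior_univ] at this
    exact Set.univ_subset_iff.1 (this.trans_subset interior_subset)
  by_cases ne₁ : interior K₁ = ∅
  · have hc := drop (K₂ ∪ K₃) K₁ (cl₂.union cl₃) ne₁ (by rw [← cover]; ac_rfl)
    have := card_le_of_two_cells hlines hA cl₂ cl₃ cv₂ cv₃ d₂₃ hc hne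
    have : mu A K₂ * mu A K₃ ≤ mu A K₁ * (mu A K₂ * mu A K₃) := Nat.le_mul_of_pos_left _ pos₁
    rw [mul_assoc]
    omega
  by_cases ne₂ : interior K₂ = ∅
  · have hc := drop (K₃ ∪ K₁) K₂ (cl₃.union cl₁) ne₂ (by rw [← cover]; ac_rfl)
    have := card_le_of_two_cells hlines hA cl₃ cl₁ cv₃ cv₁ d₃₁ hc hne
    have : mu A K₃ * mu A K₁ ≤ mu A K₂ * (mu A K₃ * mu A K₁) := Nat.le_mul_of_pos_left _ pos₂
    have e : mu A K₁ * mu A K₂ * mu A K₃ = mu A K₂ * (mu A K₃ * mu A K₁) := by ring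
    rw [e]
    omega
  by_cases ne₃ : interior K₃ = ∅
  · have hc := drop (K₁ ∪ K₂) K₃ (cl₁.union cl₂) ne₃ cover
    have := card_le_of_two_cells hlines hA cl₁ cl₂ cv₁ cv₂ d₁₂ hc hne
    have : mu A K₁ * mu A K₂ ≤ mu A K₁ * mu A K₂ * mu A K₃ := Nat.le_mul_of_pos_right _ pos₃
    omega
  rw [← ne_eq, ← Set.nonempty_iff_ne_empty] at ne₁ ne₂ ne₃
  have cover' : ∀ p, p ∈ K₁ ∨ p ∈ K₂ ∨ p ∈ K₃ := fun p => by
    have : p ∈ K₁ ∪ K₂ ∪ K₃ := by rw [cover]; trivial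
    simpa [or_assoc] using this
  have b₁ := card_filter_walls_le hlines hA cl₁ cl₂ cl₃ cv₁ cv₂ cv₃ ne₁ ne₂ ne₃ d₁₂ d₂₃ d₃₁
    cover'
  have b₂ := card_filter_walls_le hlines hA cl₂ cl₃ cl₁ cv₂ cv₃ cv₁ ne₂ ne₃ ne₁ d₂₃ d₃₁ d₁₂
    fun p => by have := cover' p; tauto
  have b₃ := card_filter_walls_le hlines hA cl₃ cl₁ cl₂ cv₃ cv₁ cv₂ ne₃ ne₁ ne₂ d₃₁ d₁₂ d₂₃
    fun p => by have := cover' p; tauto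
  have e₂ : mu A K₂ * mu A K₃ * mu A K₁ = mu A K₁ * mu A K₂ * mu A K₃ := by ring
  have e₃ : mu A K₃ * mu A K₁ * mu A K₂ = mu A K₁ * mu A K₂ * mu A K₃ := by ring
  rw [e₂] at b₂
  rw [e₃] at b₃
  rw [Finset.card_filter] at b₁ b₂ b₃
  have count : 2 * A.card ≤
      (∑ ℓ ∈ A, if (ℓ ∩ (K₁ ∩ K₂)).Nonempty → (ℓ ∩ (K₂ ∩ K₃)).Nonempty then 1 else 0) +
      (∑ ℓ ∈ A, if (ℓ ∩ (K₂ ∩ K₃)).Nonempty → (ℓ ∩ (K₃ ∩ K₁)).Nonempty then 1 else 0) +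
      ∑ ℓ ∈ A, if (ℓ ∩ (K₃ ∩ K₁)).Nonempty → (ℓ ∩ (K₁ ∩ K₂)).Nonempty then 1 else 0 := by
    rw [← Finset.sum_add_distrib, ← Finset.sum_add_distrib, mul_comm, ← smul_eq_mul,
      ← Finset.sum_const]
    refine Finset.sum_le_sum fun ℓ _ => ?_
    by_cases p₁ : (ℓ ∩ (K₁ ∩ K₂)).Nonempty <;> by_cases p₂ : (ℓ ∩ (K₂ ∩ K₃)).Nonempty <;>
      by_cases p₃ : (ℓ ∩ (K₃ ∩ K₁)).Nonempty <;> simp [p₁, p₂, p₃]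
  omega

/-- **Claim (good partition).** Let `A` consist of `n` lines in general position, let
`r₁ + r₂ + r₃ = r` with each `rᵢ > 0` and `M_i = ⌈(2n/3)^{r_i/r}⌉ − 2`.  If `(C₁, C₂, C₃)`
is a convex partition with `μ_A(C₁) ≤ M₁ + 1` and `μ_A(C₂) ≤ M₂ + 1`, then
`μ_A(C₃) ≥ M₃`. -/
theorem good_partition (n : ℕ) (A : Finset (Set (ℝ × ℝ)))
    (hlines : ∀ ℓ ∈ A, IsLine ℓ) (hcard : A.card = n) (hgp : GenPos A)
    (r₁ r₂ r₃ r : ℕ) (h₁ : 0 < r₁) (h₂ : 0 < r₂) (h₃ : 0 < r₃) (hsum : r₁ + r₂ + r₃ = r)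
    (C : Fin 3 → Set (ℝ × ℝ)) (hC : ConvexPartition C)
    (hμ₁ : (mu A (C 0) : ℤ) ≤ (⌈(2 * n / 3 : ℝ) ^ ((r₁ : ℝ) / r)⌉ - 2) + 1)
    (hμ₂ : (mu A (C 1) : ℤ) ≤ (⌈(2 * n / 3 : ℝ) ^ ((r₂ : ℝ) / r)⌉ - 2) + 1) :
    ⌈(2 * n / 3 : ℝ) ^ ((r₃ : ℝ) / r)⌉ - 2 ≤ (mu A (C 2) : ℤ) := by
  have hsum' : (r₁ : ℝ) / r + (r₂ : ℝ) / r + (r₃ : ℝ) / r = 1 := by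
    rw [← add_div, ← add_div, div_eq_one_iff_eq]
    · exact_mod_cast hsum
    · exact_mod_cast (by omega : r ≠ 0)
  have hr₃ : (r₃ : ℝ) / r ≠ 0 :=
    div_ne_zero (by exact_mod_cast h₃.ne') (by exact_mod_cast (by omega : r ≠ 0))
  rcases A.eq_empty_or_nonempty with rfl | hne
  · obtain rfl : n = 0 := by simpa using hcard.symm
    have : (2 * (0 : ℕ) / 3 : ℝ) ^ ((r₃ : ℝ) / r) = 0 := by simp [Real.zero_rpow hr₃]
    rw [this, Int.ceil_zero]
    omega
  obtain ⟨hcl, hcv, hun, hdisj⟩ := hC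
  have main := two_mul_card_le hlines hgp.1 hne (hcl 0) (hcl 1) (hcl 2) (hcv 0) (hcv 1) (hcv 2)
    (hdisj (by decide)) (hdisj (by decide)) (hdisj (by decide)) (by
      rw [← hun]
      ext p
      simp [Fin.exists_fin_succ, or_assoc])
  rw [hcard] at main
  by_contra! hlt
  have hn : 0 < n := hcard ▸ hne.card_pos
  have hN : (0 : ℝ) < 2 * n / 3 := by positivity
  have m₁ : (mu A (C 0) : ℝ) < (2 * n / 3 : ℝ) ^ ((r₁ : ℝ) / r) := by
    have := Int.lt_ceil.1 (by omega : (mu A (C 0) : ℤ) < ⌈(2 * n / 3 : ℝ) ^ ((r₁ : ℝ) / r)⌉)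
    exact_mod_cast this
  have m₂ : (mu A (C 1) : ℝ) < (2 * n / 3 : ℝ) ^ ((r₂ : ℝ) / r) := by
    have := Int.lt_ceil.1 (by omega : (mu A (C 1) : ℤ) < ⌈(2 * n / 3 : ℝ) ^ ((r₂ : ℝ) / r)⌉)
    exact_mod_cast this
  have m₃ : (mu A (C 2) : ℝ) + 2 < (2 * n / 3 : ℝ) ^ ((r₃ : ℝ) / r) := by
    have := Int.lt_ceil.1
      (by omega : (mu A (C 2) : ℤ) + 2 < ⌈(2 * n / 3 : ℝ) ^ ((r₃ : ℝ) / r)⌉)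
    exact_mod_cast this
  have hprod : (mu A (C 0) : ℝ) * mu A (C 1) * (mu A (C 2) + 2) < 2 * n / 3 := by
    calc (mu A (C 0) : ℝ) * mu A (C 1) * (mu A (C 2) + 2)
        < (2 * n / 3 : ℝ) ^ ((r₁ : ℝ) / r) * (2 * n / 3 : ℝ) ^ ((r₂ : ℝ) / r) *
          (2 * n / 3 : ℝ) ^ ((r₃ : ℝ) / r) := by gcongr
      _ = 2 * n / 3 := by
        rw [← Real.rpow_add hN, ← Real.rpow_add hN, hsum', Real.rpow_one]
  have pos₁ : (1 : ℝ) ≤ mu A (C 0) := by exact_mod_cast one_le_mu hne (C 0)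
  have pos₂ : (1 : ℝ) ≤ mu A (C 1) := by exact_mod_cast one_le_mu hne (C 1)
  have main' : (2 * n : ℝ) ≤ 3 * (mu A (C 0) * mu A (C 1) * mu A (C 2) + 2) := by
    exact_mod_cast main
  nlinarith [mul_le_mul pos₁ pos₂ zero_le_one (by positivity)]
end

section
/- Let B be a set of n lines in ℝ² in general position, let r₁, r₂, r₃ be positive integers with r₁ + r₂ + r₃ = r, and let (C₁, C₂, C₃) be a convex partition of ℝ² into three parts. Then there exists some i ∈ {1, 2, 3} with μ_B(C_i) ≥ (2n/3)^{r_i/r} − 2. -/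
open scoped Classical

/-- The recession cone of a nonempty set in the plane (empty for the empty set). -/
def recCone (C : Set (ℝ × ℝ)) : Set (ℝ × ℝ) :=
  {d | C.Nonempty ∧ ∀ x ∈ C, ∀ t : ℝ, 0 ≤ t → x + t • d ∈ C}

/-- The determinant of two plane vectors. -/
def planeDet (u v : ℝ × ℝ) : ℝ := u.1 * v.2 - u.2 * v.1

/-- `d` is a direction vector of the line `L`. -/
def IsDirection (L : Set (ℝ × ℝ)) (d : ℝ × ℝ) : Prop :=
  d ≠ 0 ∧ ∀ p ∈ L, ∀ x, x ∈ L ↔ ∃ t : ℝ, x = p + t • d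

theorem add_mem_recCone {C : Set (ℝ × ℝ)} {d e : ℝ × ℝ} (hd : d ∈ recCone C)
    (he : e ∈ recCone C) : d + e ∈ recCone C := by
  refine ⟨hd.1, fun x hx t ht => ?_⟩
  have := he.2 _ (hd.2 x hx t ht) t ht
  rwa [add_assoc, ← smul_add] at this

theorem smul_mem_recCone {C : Set (ℝ × ℝ)} {d : ℝ × ℝ} (hd : d ∈ recCone C) {s : ℝ}
    (hs : 0 ≤ s) : s • d ∈ recCone C := by
  refine ⟨hd.1, fun x hx t ht => ?_⟩
  rw [smul_smul]
  exact hd.2 x hx _ (mul_nonneg ht hs)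

theorem smul_mem_recCone_of_neg_mem {C : Set (ℝ × ℝ)} {d : ℝ × ℝ} (hd : d ∈ recCone C)
    (hd' : -d ∈ recCone C) (s : ℝ) : s • d ∈ recCone C := by
  rcases le_total 0 s with hs | hs
  · exact smul_mem_recCone hd hs
  · have := smul_mem_recCone hd' (neg_nonneg.2 hs)
    rwa [smul_neg, neg_smul, neg_neg] at this

theorem eq_univ_of_recCone_eq_univ {C : Set (ℝ × ℝ)} (h : recCone C = Set.univ) :
    C = Set.univ := by
  obtain ⟨x, hx⟩ := (h.symm ▸ Set.mem_univ (0 : ℝ × ℝ) : (0 : ℝ × ℝ) ∈ recCone C).1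
  refine Set.eq_univ_of_forall fun y => ?_
  have := (h.symm ▸ Set.mem_univ (y - x) : y - x ∈ recCone C).2 x hx 1 zero_le_one
  rwa [one_smul, add_sub_cancel] at this

theorem eq_combination_of_planeDet_ne_zero {u v : ℝ × ℝ} (h : planeDet u v ≠ 0) (w : ℝ × ℝ) :
    w = (planeDet w v / planeDet u v) • u + (planeDet u w / planeDet u v) • v := by
  have h' : u.1 * v.2 - u.2 * v.1 ≠ 0 := h
  ext <;> simp only [planeDet, Prod.fst_add, Prod.snd_add, Prod.smul_fst, Prod.smul_snd,
    smul_eq_mul, div_mul_eq_mul_div] <;> rw [← add_div, eq_div_iff h'] <;> ring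

theorem recCone_eq_univ_of_lines {C : Set (ℝ × ℝ)} {u v : ℝ × ℝ} (h : planeDet u v ≠ 0)
    (hu : u ∈ recCone C) (hu' : -u ∈ recCone C) (hv : v ∈ recCone C) (hv' : -v ∈ recCone C) :
    recCone C = Set.univ := by
  refine Set.eq_univ_of_forall fun w => ?_
  rw [eq_combination_of_planeDet_ne_zero h w]
  exact add_mem_recCone (smul_mem_recCone_of_neg_mem hu hu' _)
    (smul_mem_recCone_of_neg_mem hv hv' _)

theorem planeDet_pos_trans {C : Set (ℝ × ℝ)} (hC : recCone C ≠ Set.univ) {u v w : ℝ × ℝ}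
    (hu : u ∈ recCone C) (hv : v ∈ recCone C) (hw : w ∈ recCone C)
    (huv : 0 < planeDet u v) (hvw : 0 < planeDet v w) (huw : planeDet u w ≠ 0) :
    0 < planeDet u w := by
  by_contra hneg
  have hwu : planeDet u w < 0 := lt_of_le_of_ne (not_lt.1 hneg) huw
  have key : ∀ a b c : ℝ × ℝ, a ∈ recCone C → b ∈ recCone C → c ∈ recCone C →
      0 < planeDet a b → 0 < planeDet b c → 0 < planeDet c a → -a ∈ recCone C := by
    intro a b c _ hb hc h1 h2 h3
    have h2' : planeDet b c ≠ 0 := h2.ne'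
    have e : -a = (planeDet c a / planeDet b c) • b + (planeDet a b / planeDet b c) • c := by
      rw [eq_combination_of_planeDet_ne_zero h2' (-a)]
      congr 3 <;> simp only [planeDet, Prod.fst_neg, Prod.snd_neg] <;> ring
    rw [e]
    exact add_mem_recCone (smul_mem_recCone hb (by positivity))
      (smul_mem_recCone hc (by positivity))
  have hwu' : 0 < planeDet w u := by
    have : planeDet w u = -planeDet u w := by simp only [planeDet]; ring
    linarith
  exact hC (recCone_eq_univ_of_lines huv.ne' hu (key u v w hu hv hw huv hvw hwu') hv
    (key v w u hv hw hu hvw hwu' huv))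

theorem IsLine.exists_isDirection {L : Set (ℝ × ℝ)} (hL : IsLine L) : ∃ d, IsDirection L d := by
  obtain ⟨a, b, c, hab, rfl⟩ := hL
  have h0 : a ^ 2 + b ^ 2 ≠ 0 := by
    intro h
    apply hab
    have ha : a = 0 := by nlinarith [sq_nonneg a, sq_nonneg b]
    have hb : b = 0 := by nlinarith [sq_nonneg a, sq_nonneg b]
    rw [ha, hb]
  refine ⟨(-b, a), ?_, ?_⟩
  · intro h
    apply hab
    simp only [Prod.mk_eq_zero, neg_eq_zero] at h
    rw [h.1, h.2]
  · rintro ⟨p, q⟩ hp ⟨x, y⟩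
    simp only [Set.mem_ofPred_eq, Prod.smul_mk, Prod.mk_add_mk, Prod.mk.injEq, smul_eq_mul]
      at hp ⊢
    constructor
    · intro hx
      refine ⟨(a * (y - q) - b * (x - p)) / (a ^ 2 + b ^ 2), ?_, ?_⟩
      · field_simp
        linear_combination a * (hx - hp)
      · field_simp
        linear_combination b * (hx - hp)
    · rintro ⟨t, rfl, rfl⟩
      linear_combination hp

theorem IsDirection.neg {L : Set (ℝ × ℝ)} {d : ℝ × ℝ} (h : IsDirection L d) :
    IsDirection L (-d) := by
  refine ⟨neg_ne_zero.2 h.1, fun p hp x => (h.2 p hp x).trans ?_⟩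
  constructor
  · rintro ⟨t, rfl⟩
    exact ⟨-t, by simp⟩
  · rintro ⟨t, rfl⟩
    exact ⟨-t, by simp⟩

theorem NotParallel.planeDet_ne_zero {L M : Set (ℝ × ℝ)} {u v : ℝ × ℝ} (h : NotParallel L M)
    (hu : IsDirection L u) (hv : IsDirection M v) : planeDet u v ≠ 0 := by
  intro h0
  obtain ⟨p, ⟨hpL, hpM⟩, hp⟩ := h
  obtain ⟨k, hk⟩ : ∃ k : ℝ, u = k • v := by
    have hv0 : v.1 ^ 2 + v.2 ^ 2 ≠ 0 := by
      intro h
      apply hv.1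
      ext
      · show v.1 = 0
        nlinarith [sq_nonneg v.1, sq_nonneg v.2]
      · show v.2 = 0
        nlinarith [sq_nonneg v.1, sq_nonneg v.2]
    refine ⟨(u.1 * v.1 + u.2 * v.2) / (v.1 ^ 2 + v.2 ^ 2), ?_⟩
    simp only [planeDet] at h0
    ext
    · simp only [Prod.smul_fst, smul_eq_mul]
      field_simp
      linear_combination v.2 * h0
    · simp only [Prod.smul_snd, smul_eq_mul]
      field_simp
      linear_combination -v.1 * h0
  have hq := hp (p + u) ⟨(hu.2 p hpL _).2 ⟨1, by simp⟩, (hv.2 p hpM _).2 ⟨k, by rw [hk]⟩⟩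
  exact hu.1 (by simpa using hq)

/-- If two crossings of a middle line with lines on both sides of it lie in `C`, so does the
crossing of the outer lines. -/
theorem crossing_mem_of_crossing_mem {C : Set (ℝ × ℝ)} {L M N : Set (ℝ × ℝ)} {u v w : ℝ × ℝ}
    (hL : IsDirection L u) (hM : IsDirection M v) (hN : IsDirection N w)
    (hu : u ∈ recCone C) (hw : w ∈ recCone C)
    (huv : 0 < planeDet u v) (hvw : 0 < planeDet v w) (huw : 0 < planeDet u w)
    {p q : ℝ × ℝ} (hpL : p ∈ L) (hpM : p ∈ M) (hqM : q ∈ M) (hqN : q ∈ N)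
    (hp : p ∈ C) (hq : q ∈ C) : ∃ x ∈ C, x ∈ L ∧ x ∈ N := by
  obtain ⟨t, ht⟩ := (hM.2 q hqM p).1 hpM
  obtain ⟨a, b, ha, hb, hv⟩ : ∃ a b : ℝ, 0 ≤ a ∧ 0 ≤ b ∧ v = a • u + b • w :=
    ⟨_, _, (div_pos hvw huw).le, (div_pos huv huw).le, eq_combination_of_planeDet_ne_zero huw.ne' v⟩
  have e : q + (t * b) • w = p + (-(t * a)) • u := by
    rw [ht, hv]
    module
  have hqL : q + (t * b) • w ∈ L := by
    rw [e]
    exact (hL.2 p hpL _).2 ⟨_, rfl⟩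
  refine ⟨q + (t * b) • w, ?_, hqL, (hN.2 q hqN _).2 ⟨_, rfl⟩⟩
  rcases le_total 0 t with h | h
  · exact hw.2 q hq _ (mul_nonneg h hb)
  · rw [e]
    exact hu.2 p hp _ (by nlinarith)

/-- Mirsky's theorem in product form: a finite set whose chains have at most `m` elements and whose
antichains have at most `k` elements has at most `k * m` elements. -/
theorem card_le_mul_of_chain_antichain {α : Type*} (S : Finset α) (r : α → α → Prop)
    (hirr : ∀ x, ¬ r x x)
    (htrans : ∀ x ∈ S, ∀ y ∈ S, ∀ z ∈ S, r x y → r y z → r x z) (m k : ℕ)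
    (hm : ∀ T ⊆ S, (∀ x ∈ T, ∀ y ∈ T, x ≠ y → r x y ∨ r y x) → T.card ≤ m)
    (hk : ∀ T ⊆ S, (∀ x ∈ T, ∀ y ∈ T, ¬ r x y) → T.card ≤ k) :
    S.card ≤ k * m := by
  let F : α → Finset (Finset α) := fun x => S.powerset.filter fun T =>
    (∀ y ∈ T, ∀ z ∈ T, y ≠ z → r y z ∨ r z y) ∧ x ∈ T ∧ ∀ y ∈ T, y ≠ x → r y x
  let h : α → ℕ := fun x => (F x).sup Finset.card
  have hF : ∀ x ∈ S, {x} ∈ F x := by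
    intro x hx
    simp [F, hx]
  have hmono : ∀ x ∈ S, ∀ y ∈ S, r x y → h x < h y := by
    intro x hx y hy hxy
    obtain ⟨T, hT, hTc⟩ := Finset.exists_mem_eq_sup (F x) ⟨_, hF x hx⟩ Finset.card
    obtain ⟨hTS, hch, hxT, htop⟩ : T ⊆ S ∧ (∀ y ∈ T, ∀ z ∈ T, y ≠ z → r y z ∨ r z y) ∧ x ∈ T ∧
        ∀ y ∈ T, y ≠ x → r y x := by simpa [F] using hT
    have hall : ∀ z ∈ T, r z y := by
      intro z hz
      by_cases hzx : z = x
      · rwa [hzx]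
      · exact htrans z (hTS hz) x hx y hy (htop z hz hzx) hxy
    have hyT : y ∉ T := fun hyT => hirr y (hall y hyT)
    have hins : insert y T ∈ F y := by
      simp only [F, Finset.mem_filter, Finset.mem_powerset]
      refine ⟨Finset.insert_subset hy hTS, ?_, Finset.mem_insert_self _ _, ?_⟩
      · intro a ha b hb hab
        rcases Finset.mem_insert.1 ha with rfl | ha' <;>
          rcases Finset.mem_insert.1 hb with rfl | hb'
        · exact absurd rfl hab
        · exact Or.inr (hall b hb')
        · exact Or.inl (hall a ha')
        · exact hch a ha' b hb' hab
      · intro a ha hay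
        exact hall a ((Finset.mem_insert.1 ha).resolve_left hay)
    have h1 : (insert y T).card ≤ h y := Finset.le_sup (f := Finset.card) hins
    rw [Finset.card_insert_of_notMem hyT] at h1
    have h2 : h x = T.card := hTc
    omega
  have hmaps : ∀ x ∈ S, h x ∈ Finset.Icc 1 m := by
    intro x hx
    rw [Finset.mem_Icc]
    constructor
    · exact (Finset.card_singleton x).symm.le.trans (Finset.le_sup (f := Finset.card) (hF x hx))
    · refine Finset.sup_le fun T hT => ?_
      simp only [F, Finset.mem_filter, Finset.mem_powerset] at hT
      exact hm T hT.1 hT.2.1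
  have := Finset.card_le_mul_card_image_of_maps_to hmaps k fun b _ => by
    refine hk _ (Finset.filter_subset _ _) fun x hx y hy hxy => ?_
    rw [Finset.mem_filter] at hx hy
    exact (hmono x hx.1 y hy.1 hxy).ne (hx.2.trans hy.2.symm)
  simpa using this

/-- If all lines of `S` have directions in the recession cone of `C`, then `S` has at most `k * m`
lines, where `m` bounds the subfamilies crossing only inside `C` and `k` those crossing only
outside. -/
theorem card_le_mul_of_crossings {S : Finset (Set (ℝ × ℝ))} (hS : PairwiseNonParallel S)
    {C : Set (ℝ × ℝ)} (hC : recCone C ≠ Set.univ)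
    (hdir : ∀ ℓ ∈ S, ∃ d ∈ recCone C, IsDirection ℓ d) (m k : ℕ)
    (hm : ∀ T ⊆ S, incSet T ⊆ C → T.card ≤ m)
    (hk : ∀ T ⊆ S, incSet T ⊆ Cᶜ → T.card ≤ k) : S.card ≤ k * m := by
  choose! dir hdC hd using hdir
  have hne : ∀ x ∈ S, ∀ y ∈ S, x ≠ y → planeDet (dir x) (dir y) ≠ 0 := fun x hx y hy hxy =>
    (hS x hx y hy hxy).planeDet_ne_zero (hd x hx) (hd y hy)
  have hself : ∀ u, planeDet u u = 0 := fun u => by simp only [planeDet]; ring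
  have hswap : ∀ u v, planeDet u v = -planeDet v u := fun u v => by simp only [planeDet]; ring
  refine card_le_mul_of_chain_antichain S
    (fun x y => 0 < planeDet (dir x) (dir y) ∧ ∃ p ∈ C, p ∈ x ∧ p ∈ y) ?_ ?_ m k ?_ ?_
  · rintro x ⟨h, -⟩
    rw [hself] at h
    exact lt_irrefl _ h
  · rintro x hx y hy z hz ⟨hxy, p, hp, hpx, hpy⟩ ⟨hyz, q, hq, hqy, hqz⟩
    have hxz : x ≠ z := by
      rintro rfl
      rw [hswap] at hyz
      linarith
    have hpos := planeDet_pos_trans hC (hdC x hx) (hdC y hy) (hdC z hz) hxy hyz (hne x hx z hz hxz)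
    exact ⟨hpos, crossing_mem_of_crossing_mem (hd x hx) (hd y hy) (hd z hz) (hdC x hx) (hdC z hz)
      hxy hyz hpos hpx hpy hqy hqz hp hq⟩
  · intro T hT hch
    refine hm T hT ?_
    rintro p ⟨x, hx, y, hy, hxy, hpx, hpy⟩
    have : ∃ q ∈ C, q ∈ x ∧ q ∈ y := by
      rcases hch x hx y hy hxy with ⟨-, h⟩ | ⟨-, q, hq, hqy, hqx⟩
      · exact h
      · exact ⟨q, hq, hqx, hqy⟩
    obtain ⟨q, hq, hqx, hqy⟩ := this
    rwa [(hS x (hT hx) y (hT hy) hxy).unique ⟨hpx, hpy⟩ ⟨hqx, hqy⟩]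
  · intro T hT hanti
    refine hk T hT ?_
    rintro p ⟨x, hx, y, hy, hxy, hpx, hpy⟩ hpC
    rcases (hne x (hT hx) y (hT hy) hxy).lt_or_gt with h | h
    · exact hanti y hy x hx ⟨by rw [hswap]; linarith, p, hpC, hpy, hpx⟩
    · exact hanti x hx y hy ⟨h, p, hpC, hpx, hpy⟩

theorem card_le_mu_s14 {A T : Finset (Set (ℝ × ℝ))} {K : Set (ℝ × ℝ)} (hT : T ⊆ A)
    (h : incSet T ⊆ K) : T.card ≤ mu A K :=
  Finset.le_sup (f := Finset.card) (Finset.mem_filter.2 ⟨Finset.mem_powerset.2 hT, h⟩)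

theorem compl_subset_of_interior_eq_empty {C D E : Set (ℝ × ℝ)} (hC : IsClosed C) (hE : IsClosed E)
    (hcov : ∀ x, x ∈ C ∨ x ∈ D ∨ x ∈ E) (hD : interior D = ∅) : Cᶜ ⊆ E := by
  intro x hx
  by_contra hxE
  have hsub : Cᶜ ∩ Eᶜ ⊆ interior D := by
    refine interior_maximal ?_ (hC.isOpen_compl.inter hE.isOpen_compl)
    rintro y ⟨hyC, hyE⟩
    rcases hcov y with h | h | h
    · exact absurd h hyC
    · exact h
    · exact absurd h hyE
  rw [hD] at hsub
  exact hsub ⟨hx, hxE⟩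

/-- The lines with direction in the recession cone of one part number at most the product of the
three `mu`s (each increased by one). -/
theorem card_le_mu_mul {B S : Finset (Set (ℝ × ℝ))} (hB : PairwiseNonParallel B)
    (hlines : ∀ ℓ ∈ B, IsLine ℓ) (hSB : S ⊆ B) {C D E : Set (ℝ × ℝ)} (hCc : IsClosed C)
    (hDc : IsClosed D) (hEc : IsClosed E) (hDx : Convex ℝ D) (hEx : Convex ℝ E)
    (hcov : ∀ x, x ∈ C ∨ x ∈ D ∨ x ∈ E) (hdisj : interior D ∩ interior E = ∅)
    (hC : recCone C ≠ Set.univ) (hdir : ∀ ℓ ∈ S, ∃ d ∈ recCone C, IsDirection ℓ d) :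
    S.card ≤ (mu B C + 1) * (mu B D + 1) * (mu B E + 1) := by
  have hS : ∀ T ⊆ B, PairwiseNonParallel T := fun T hT x hx y hy =>
    hB x (hT hx) y (hT hy)
  have main : ∀ k, (∀ T ⊆ S, incSet T ⊆ Cᶜ → T.card ≤ k) → S.card ≤ k * mu B C := fun k hk =>
    card_le_mul_of_crossings (hS S hSB) hC hdir _ k (fun T hT h => card_le_mu_s14 (hT.trans hSB) h) hk
  rcases Set.eq_empty_or_nonempty (interior D) with hD0 | hD0
  · have hsub := compl_subset_of_interior_eq_empty hCc hEc hcov hD0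
    have := main (mu B E) fun T hT h => card_le_mu_s14 (hT.trans hSB) (h.trans hsub)
    nlinarith [Nat.zero_le (mu B C * mu B D * mu B E), Nat.zero_le (mu B C * mu B D),
      Nat.zero_le (mu B D * mu B E)]
  rcases Set.eq_empty_or_nonempty (interior E) with hE0 | hE0
  · have hsub := compl_subset_of_interior_eq_empty hCc hDc
      (fun x => (hcov x).imp_right Or.symm) hE0
    have := main (mu B D) fun T hT h => card_le_mu_s14 (hT.trans hSB) (h.trans hsub)
    nlinarith [Nat.zero_le (mu B C * mu B D * mu B E), Nat.zero_le (mu B C * mu B E),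
      Nat.zero_le (mu B D * mu B E)]
  obtain ⟨f, c, hfD, hfE⟩ := geometric_hahn_banach_open_open hDx.interior isOpen_interior
    hEx.interior isOpen_interior (Set.disjoint_iff_inter_eq_empty.2 hdisj)
  have hD : ∀ x ∈ D, f x ≤ c := by
    have : closure (interior D) ⊆ {x | f x ≤ c} :=
      closure_minimal (fun x hx => (hfD x hx).le) (isClosed_le f.continuous continuous_const)
    rw [hDx.closure_interior_eq_closure_of_nonempty_interior hD0] at this
    exact fun x hx => this (subset_closure hx)
  have hE : ∀ x ∈ E, c ≤ f x := by
    have : closure (interior E) ⊆ {x | c ≤ f x} :=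
      closure_minimal (fun x hx => (hfE x hx).le) (isClosed_le continuous_const f.continuous)
    rw [hEx.closure_interior_eq_closure_of_nonempty_interior hE0] at this
    exact fun x hx => this (subset_closure hx)
  obtain ⟨a, ha⟩ := hD0
  obtain ⟨b, hb⟩ := hE0
  have hab : f (a - b) < 0 := by
    rw [map_sub]
    linarith [hfD a ha, hfE b hb]
  let Q : Set (ℝ × ℝ) := {x | f x ≤ c}
  have hQrec : ∀ d, f d ≤ 0 → d ∈ recCone Q := by
    refine fun d hd => ⟨⟨a, (hfD a ha).le⟩, fun x hx t ht => ?_⟩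
    have hx' : f x ≤ c := hx
    show f (x + t • d) ≤ c
    rw [map_add, map_smul, smul_eq_mul]
    nlinarith
  have hQ : recCone Q ≠ Set.univ := by
    intro h
    have h1 : b ∈ Q := eq_univ_of_recCone_eq_univ h ▸ Set.mem_univ b
    exact absurd (hfE b hb) (not_lt.2 h1)
  have hDsub : ∀ x ∉ C, f x ≤ c → x ∈ D := by
    intro x hxC hx
    have hlim : Filter.Tendsto (fun t : ℝ => x + t • (a - b)) (nhdsWithin 0 (Set.Ioi 0))
        (nhds x) := by
      have : Continuous fun t : ℝ => x + t • (a - b) := by fun_prop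
      exact (this.tendsto' 0 x (by simp)).mono_left nhdsWithin_le_nhds
    refine hDc.mem_of_tendsto hlim ?_
    filter_upwards [hlim.eventually (hCc.isOpen_compl.mem_nhds hxC), self_mem_nhdsWithin]
      with t ht1 ht2
    have ht2' : (0 : ℝ) < t := ht2
    rcases hcov (x + t • (a - b)) with h | h | h
    · exact absurd h ht1
    · exact h
    · have h3 := hE _ h
      rw [map_add, map_smul, smul_eq_mul] at h3
      nlinarith
  have := main (mu B E * mu B D) fun T hT hTC => by
    refine card_le_mul_of_crossings (hS T (hT.trans hSB)) hQ ?_ _ _ ?_ ?_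
    · intro ℓ hℓ
      obtain ⟨d, hd⟩ := (hlines ℓ (hSB (hT hℓ))).exists_isDirection
      rcases le_total (f d) 0 with h | h
      · exact ⟨d, hQrec d h, hd⟩
      · exact ⟨-d, hQrec (-d) (by rw [map_neg]; linarith), hd.neg⟩
    · intro U hU hUQ
      have hinc : incSet U ⊆ incSet T := by
        rintro p ⟨x, hx, y, hy, h⟩
        exact ⟨x, hU hx, y, hU hy, h⟩
      exact card_le_mu_s14 (hU.trans (hT.trans hSB)) fun p hp => hDsub p (hTC (hinc hp)) (hUQ hp)
    · intro U hU hUQ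
      have hinc : incSet U ⊆ incSet T := by
        rintro p ⟨x, hx, y, hy, h⟩
        exact ⟨x, hU hx, y, hU hy, h⟩
      refine card_le_mu_s14 (hU.trans (hT.trans hSB)) fun p hp => ?_
      rcases hcov p with h | h | h
      · exact absurd h (hTC (hinc hp))
      · exact absurd (hD p h) (hUQ hp)
      · exact h
  nlinarith [Nat.zero_le (mu B C * mu B D), Nat.zero_le (mu B D * mu B E),
    Nat.zero_le (mu B C * mu B E)]

theorem exists_mem_recCone {ι : Type*} [Finite ι] {C : ι → Set (ℝ × ℝ)}
    (hclosed : ∀ i, IsClosed (C i)) (hconv : ∀ i, Convex ℝ (C i)) (hcov : ⋃ i, C i = Set.univ)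
    (d : ℝ × ℝ) : ∃ i, d ∈ recCone (C i) := by
  have hfreq : ∃ i, ∃ᶠ n : ℕ in Filter.atTop, (n : ℝ) • d ∈ C i := by
    by_contra! h
    obtain ⟨n, hn⟩ := (Filter.eventually_all.2 h).exists
    have : (n : ℝ) • d ∈ ⋃ i, C i := hcov ▸ Set.mem_univ _
    obtain ⟨i, hi⟩ := Set.mem_iUnion.1 this
    exact hn i hi
  obtain ⟨i, hi⟩ := hfreq
  obtain ⟨n, hn⟩ := hi.exists
  refine ⟨i, ⟨_, hn⟩, fun x hx t ht => ?_⟩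
  have hlim0 : Filter.Tendsto (fun n : ℕ => t / (n : ℝ)) Filter.atTop (nhds 0) :=
    tendsto_const_div_atTop_nhds_zero_nat t
  have hlim : Filter.Tendsto (fun n : ℕ => x + t • d - (t / (n : ℝ)) • x) Filter.atTop
      (nhds (x + t • d)) := by
    have := (hlim0.smul_const x).const_sub (x + t • d)
    simpa using this
  refine (hclosed i).mem_of_frequently_of_tendsto ?_ hlim
  obtain ⟨N, hN⟩ := exists_nat_gt t
  refine (hi.and_eventually (Filter.eventually_ge_atTop (N + 1))).mono ?_
  rintro k ⟨hk, hkN⟩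
  have hk1 : (N : ℝ) + 1 ≤ k := by exact_mod_cast hkN
  have hkpos : (0 : ℝ) < k := by linarith [(Nat.cast_nonneg N : (0 : ℝ) ≤ N)]
  have hle : t / k ≤ 1 := (div_le_one hkpos).2 (by linarith)
  have := hconv i hx hk (sub_nonneg.2 hle) (div_nonneg ht hkpos.le) (by ring)
  rwa [smul_smul, div_mul_cancel₀ _ hkpos.ne', sub_smul, one_smul, sub_add_eq_add_sub] at this

/-- Among pairwise non-parallel lines, at most one has its direction in fewer than two of the three
double cones spanned by the recession cones. -/
theorem eq_of_unique_recCone {C : Fin 3 → Set (ℝ × ℝ)}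
    (hcov : ∀ d, ∃ i, d ∈ recCone (C i)) (hC : ∀ i, recCone (C i) ≠ Set.univ) {u v : ℝ × ℝ}
    {i j : Fin 3} (hu : ∀ k, u ∈ recCone (C k) ∨ -u ∈ recCone (C k) → k = i)
    (hv : ∀ k, v ∈ recCone (C k) ∨ -v ∈ recCone (C k) → k = j) : planeDet u v = 0 := by
  by_contra h0
  have key : ∀ (w : ℝ × ℝ) (l : Fin 3), (∀ k, w ∈ recCone (C k) ∨ -w ∈ recCone (C k) → k = l) →
      w ∈ recCone (C l) ∧ -w ∈ recCone (C l) := by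
    intro w l hw
    obtain ⟨k, hk⟩ := hcov w
    obtain ⟨k', hk'⟩ := hcov (-w)
    exact ⟨hw k (Or.inl hk) ▸ hk, hw k' (Or.inr hk') ▸ hk'⟩
  obtain ⟨hui, hui'⟩ := key u i hu
  obtain ⟨hvj, hvj'⟩ := key v j hv
  have hij : i ≠ j := by
    rintro rfl
    exact hC i (recCone_eq_univ_of_lines h0 hui hui' hvj hvj')
  obtain ⟨k, hk⟩ := hcov (u + v)
  obtain ⟨l, hl⟩ := hcov (u - v)
  have hki : k ≠ i := by
    rintro rfl
    have := add_mem_recCone hk hui'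
    rw [show u + v + -u = v by abel] at this
    exact hij (hv k (Or.inl this))
  have hkj : k ≠ j := by
    rintro rfl
    have := add_mem_recCone hk hvj'
    rw [show u + v + -v = u by abel] at this
    exact hij (hu k (Or.inl this)).symm
  have hli : l ≠ i := by
    rintro rfl
    have := add_mem_recCone hl hui'
    rw [show u - v + -u = -v by abel] at this
    exact hij (hv l (Or.inr this))
  have hlj : l ≠ j := by
    rintro rfl
    have := add_mem_recCone hl hvj
    rw [show u - v + v = u by abel] at this
    exact hij (hu l (Or.inl this)).symm
  have hkl : k = l := by omega
  subst hkl
  have h2 := smul_mem_recCone (add_mem_recCone hk hl) (s := 1 / 2) (by norm_num)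
  rw [show (1 / 2 : ℝ) • (u + v + (u - v)) = u by module] at h2
  exact hki (hu k (Or.inl h2))

theorem two_mul_card_le_mu_mul {B : Finset (Set (ℝ × ℝ))} (hlines : ∀ ℓ ∈ B, IsLine ℓ)
    (hB : PairwiseNonParallel B) {C : Fin 3 → Set (ℝ × ℝ)} (hC : ConvexPartition C) :
    2 * B.card ≤ 3 * ((mu B (C 0) + 2) * (mu B (C 1) + 2) * (mu B (C 2) + 2)) := by
  obtain ⟨hclosed, hconv, hcov, hdisj⟩ := hC
  by_cases huniv : ∃ i, C i = Set.univ
  · obtain ⟨i, hi⟩ := huniv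
    have h : B.card ≤ mu B (C i) := card_le_mu_s14 (Finset.Subset.refl B) (hi ▸ Set.subset_univ _)
    rcases (by omega : i = 0 ∨ i = 1 ∨ i = 2) with rfl | rfl | rfl <;>
    nlinarith [Nat.zero_le (mu B (C 0) * mu B (C 1) * mu B (C 2)),
      Nat.zero_le (mu B (C 0) * mu B (C 1)), Nat.zero_le (mu B (C 1) * mu B (C 2)),
      Nat.zero_le (mu B (C 0) * mu B (C 2))]
  have hrec : ∀ i, recCone (C i) ≠ Set.univ := fun i h =>
    huniv ⟨i, eq_univ_of_recCone_eq_univ h⟩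
  have hdircov := exists_mem_recCone hclosed hconv hcov
  have hcov3 : ∀ x, x ∈ C 0 ∨ x ∈ C 1 ∨ x ∈ C 2 := by
    intro x
    obtain ⟨i, hi⟩ := Set.mem_iUnion.1 (hcov.symm ▸ Set.mem_univ x : x ∈ ⋃ i, C i)
    fin_cases i
    · exact Or.inl hi
    · exact Or.inr (Or.inl hi)
    · exact Or.inr (Or.inr hi)
  let W : Fin 3 → Finset (Set (ℝ × ℝ)) := fun i =>
    B.filter fun ℓ => ∃ d ∈ recCone (C i), IsDirection ℓ d
  have hWdir : ∀ i, ∀ ℓ ∈ W i, ∃ d ∈ recCone (C i), IsDirection ℓ d := fun i ℓ hℓ =>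
    (Finset.mem_filter.1 hℓ).2
  have hWB : ∀ i, W i ⊆ B := fun i => Finset.filter_subset _ _
  have h0 := card_le_mu_mul hB hlines (hWB 0) (hclosed 0) (hclosed 1) (hclosed 2) (hconv 1)
    (hconv 2) hcov3 (hdisj (by decide)) (hrec 0) (hWdir 0)
  have h1 := card_le_mu_mul hB hlines (hWB 1) (hclosed 1) (hclosed 0) (hclosed 2) (hconv 0)
    (hconv 2) (fun x => by have := hcov3 x; tauto) (hdisj (by decide)) (hrec 1) (hWdir 1)
  have h2 := card_le_mu_mul hB hlines (hWB 2) (hclosed 2) (hclosed 0) (hclosed 1) (hconv 0)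
    (hconv 1) (fun x => by have := hcov3 x; tauto) (hdisj (by decide)) (hrec 2) (hWdir 2)
  have hcount : ∑ i, (W i).card = ∑ ℓ ∈ B, (Finset.univ.filter fun i => ℓ ∈ W i).card := by
    have h := Finset.sum_card_bipartiteAbove_eq_sum_card_bipartiteBelow (s := Finset.univ) (t := B)
      fun i ℓ => ℓ ∈ W i
    refine Eq.trans (Finset.sum_congr rfl fun i _ => congrArg Finset.card ?_) h
    exact (Finset.filter_mem_eq_inter.trans (Finset.inter_eq_right.2 (hWB i))).symm
  let G := B.filter fun ℓ => 2 ≤ (Finset.univ.filter fun i => ℓ ∈ W i).card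
  have hbad : (B \ G).card ≤ 1 := by
    rw [Finset.card_le_one]
    have hone : ∀ ℓ ∈ B \ G, ∃ d i, IsDirection ℓ d ∧
        ∀ k, d ∈ recCone (C k) ∨ -d ∈ recCone (C k) → k = i := by
      intro ℓ hℓ
      obtain ⟨hℓB, hℓG⟩ := Finset.mem_sdiff.1 hℓ
      have hlt : (Finset.univ.filter fun i => ℓ ∈ W i).card ≤ 1 := by
        by_contra h
        exact hℓG (Finset.mem_filter.2 ⟨hℓB, by omega⟩)
      obtain ⟨d, hd⟩ := (hlines ℓ hℓB).exists_isDirection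
      have hmem : ∀ k, d ∈ recCone (C k) ∨ -d ∈ recCone (C k) → ℓ ∈ W k := by
        rintro k (hk | hk)
        · exact Finset.mem_filter.2 ⟨hℓB, d, hk, hd⟩
        · exact Finset.mem_filter.2 ⟨hℓB, -d, hk, hd.neg⟩
      obtain ⟨i, hi⟩ := hdircov d
      exact ⟨d, i, hd, fun k hk => Finset.card_le_one.1 hlt k
        (by simpa using hmem k hk) i (by simpa using hmem i (Or.inl hi))⟩
    intro x hx y hy
    by_contra hxy
    obtain ⟨u, i, hu, hui⟩ := hone x hx
    obtain ⟨v, j, hv, hvj⟩ := hone y hy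
    exact (hB x (Finset.mem_sdiff.1 hx).1 y (Finset.mem_sdiff.1 hy).1 hxy).planeDet_ne_zero hu hv
      (eq_of_unique_recCone hdircov hrec hui hvj)
  have hGcard : 2 * G.card ≤ ∑ ℓ ∈ B, (Finset.univ.filter fun i => ℓ ∈ W i).card := by
    calc 2 * G.card = ∑ ℓ ∈ G, 2 := by rw [Finset.sum_const, smul_eq_mul, mul_comm]
      _ ≤ ∑ ℓ ∈ G, (Finset.univ.filter fun i => ℓ ∈ W i).card :=
        Finset.sum_le_sum fun ℓ hℓ => (Finset.mem_filter.1 hℓ).2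
      _ ≤ _ := Finset.sum_le_sum_of_subset (Finset.filter_subset _ _)
  have hsplit : (B \ G).card + G.card = B.card :=
    Finset.card_sdiff_add_card_eq_card (Finset.filter_subset _ _)
  rw [Fin.sum_univ_three] at hcount
  nlinarith [Nat.zero_le (mu B (C 0) * mu B (C 1)), Nat.zero_le (mu B (C 1) * mu B (C 2)),
      Nat.zero_le (mu B (C 0) * mu B (C 2))]

/-- **Claim (every point has a color).** Let `B` consist of `n` lines in general position,
let `r₁ + r₂ + r₃ = r` with each `rᵢ > 0`, and let `(C₁, C₂, C₃)` be a convex partition of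
the plane.  Then `μ_B(C_i) ≥ (2n/3)^{r_i/r} − 2` for some `i`. -/
theorem some_color (n : ℕ) (B : Finset (Set (ℝ × ℝ)))
    (hlines : ∀ ℓ ∈ B, IsLine ℓ) (hcard : B.card = n) (hgp : GenPos B)
    (rs : Fin 3 → ℕ) (hpos : ∀ i, 0 < rs i) (r : ℕ) (hsum : rs 0 + rs 1 + rs 2 = r)
    (C : Fin 3 → Set (ℝ × ℝ)) (hC : ConvexPartition C) :
    ∃ i : Fin 3, (2 * n / 3 : ℝ) ^ ((rs i : ℝ) / r) - 2 ≤ (mu B (C i) : ℝ) := by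
  by_contra! hcon
  have hmain := two_mul_card_le_mu_mul hlines hgp.1 hC
  rw [hcard] at hmain
  have hmain' : (2 * n / 3 : ℝ) ≤
      ((mu B (C 0) : ℝ) + 2) * ((mu B (C 1) : ℝ) + 2) * ((mu B (C 2) : ℝ) + 2) := by
    have : (2 * n : ℝ) ≤
        3 * (((mu B (C 0) : ℝ) + 2) * ((mu B (C 1) : ℝ) + 2) * ((mu B (C 2) : ℝ) + 2)) := by
      exact_mod_cast hmain
    linarith
  have hx : (0 : ℝ) ≤ 2 * n / 3 := by positivity
  have hr : (r : ℝ) ≠ 0 := by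
    have := hpos 0
    exact_mod_cast (by omega : r ≠ 0)
  have hprod : (2 * n / 3 : ℝ) = (2 * n / 3 : ℝ) ^ ((rs 0 : ℝ) / r) *
      (2 * n / 3 : ℝ) ^ ((rs 1 : ℝ) / r) * (2 * n / 3 : ℝ) ^ ((rs 2 : ℝ) / r) := by
    rw [← Real.rpow_add_of_nonneg hx (by positivity) (by positivity),
      ← Real.rpow_add_of_nonneg hx (by positivity) (by positivity), ← add_div, ← add_div]
    have : (rs 0 : ℝ) + rs 1 + rs 2 = r := by exact_mod_cast hsum
    rw [this, div_self hr, Real.rpow_one]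
  have hlt : ∀ i, (mu B (C i) : ℝ) + 2 < (2 * n / 3 : ℝ) ^ ((rs i : ℝ) / r) := fun i => by
    linarith [hcon i]
  have : ((mu B (C 0) : ℝ) + 2) * ((mu B (C 1) : ℝ) + 2) * ((mu B (C 2) : ℝ) + 2) <
      (2 * n / 3 : ℝ) ^ ((rs 0 : ℝ) / r) * (2 * n / 3 : ℝ) ^ ((rs 1 : ℝ) / r) *
        (2 * n / 3 : ℝ) ^ ((rs 2 : ℝ) / r) := by
    gcongr <;> exact hlt _
  linarith
end

section
/- Let a and r be positive integers. There exists a set A of a^r lines in ℝ² in general position such that for every partition of ℝ² into r closed vertical strips S₁, …, S_r there exists an i ∈ {1, …, r} with μ_A(S_i) ≤ a. -/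
open scoped Classical

/-- A closed vertical strip `{(x,y) : s ≤ x ≤ t}` with `s ∈ ℝ ∪ {−∞}`, `t ∈ ℝ ∪ {+∞}`. -/
def IsVerticalStrip (S : Set (ℝ × ℝ)) : Prop :=
  ∃ s t : EReal, S = {p : ℝ × ℝ | s ≤ (p.1 : EReal) ∧ (p.1 : EReal) ≤ t}

/-- The non-vertical line with slope `q.1` and intercept `q.2`. -/
def graphLine (q : ℝ × ℝ) : Set (ℝ × ℝ) := {p | p.2 = q.1 * p.1 + q.2}

lemma mem_graphLine {q p : ℝ × ℝ} : p ∈ graphLine q ↔ p.2 = q.1 * p.1 + q.2 := Iff.rfl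

lemma isLine_graphLine (q : ℝ × ℝ) : IsLine (graphLine q) := by
  refine ⟨-q.1, 1, q.2, by simp, ?_⟩
  ext p
  simp only [mem_graphLine, Set.mem_ofPred_eq]
  constructor <;> intro h <;> linarith

lemma graphLine_injective : Function.Injective graphLine := by
  intro q q' h
  have h0 : ((0 : ℝ), q.2) ∈ graphLine q' := h ▸ (by simp [mem_graphLine])
  have h1 : ((1 : ℝ), q.1 + q.2) ∈ graphLine q' := h ▸ (by simp [mem_graphLine])
  simp only [mem_graphLine] at h0 h1
  ext <;> linarith

lemma notParallel_graphLine {q q' : ℝ × ℝ} (h : q.1 ≠ q'.1) :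
    NotParallel (graphLine q) (graphLine q') := by
  have h' : q.1 - q'.1 ≠ 0 := sub_ne_zero.mpr h
  refine ⟨((q'.2 - q.2) / (q.1 - q'.1), q.1 * ((q'.2 - q.2) / (q.1 - q'.1)) + q.2),
    ⟨rfl, ?_⟩, ?_⟩
  · simp only [mem_graphLine]
    field_simp
    ring
  · rintro ⟨x, y⟩ ⟨h1, h2⟩
    simp only [mem_graphLine] at h1 h2
    have hx : x = (q'.2 - q.2) / (q.1 - q'.1) := by
      rw [eq_div_iff h']
      linarith
    ext
    · exact hx
    · rw [h1, hx]

lemma NotParallel.symm {L₁ L₂ : Set (ℝ × ℝ)} (h : NotParallel L₁ L₂) : NotParallel L₂ L₁ := by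
  unfold NotParallel at *
  rwa [Set.inter_comm]

lemma Collinear.cross_eq {p q s : ℝ × ℝ} (h : Collinear ℝ ({p, q, s} : Set (ℝ × ℝ))) :
    (q.1 - p.1) * (s.2 - p.2) = (q.2 - p.2) * (s.1 - p.1) := by
  obtain ⟨v, hv⟩ := (collinear_iff_of_mem (p₀ := p) (by simp)).1 h
  obtain ⟨a, rfl⟩ := hv q (by simp)
  obtain ⟨b, rfl⟩ := hv s (by simp)
  simp
  ring

lemma fst_ne_of_mem_graphLine {l p q : ℝ × ℝ} (hp : p ∈ graphLine l) (hq : q ∈ graphLine l)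
    (hpq : p ≠ q) : q.1 - p.1 ≠ 0 := by
  intro h
  rw [mem_graphLine] at hp hq
  have h1 : p.1 = q.1 := by linarith
  exact hpq (Prod.ext h1 (by rw [hp, hq, h1]))

lemma mem_graphLine_of_cross {l p q s : ℝ × ℝ} (hp : p ∈ graphLine l) (hq : q ∈ graphLine l)
    (hpq : p ≠ q) (h : (q.1 - p.1) * (s.2 - p.2) = (q.2 - p.2) * (s.1 - p.1)) :
    s ∈ graphLine l := by
  have h0 := fst_ne_of_mem_graphLine hp hq hpq
  rw [mem_graphLine] at *
  apply mul_left_cancel₀ h0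
  rw [hp, hq] at h
  linear_combination h

lemma mem_graphLine_of_cross_of_cross {l x x' q s : ℝ × ℝ} (hx : x ∈ graphLine l)
    (hx' : x' ∈ graphLine l) (hne : x ≠ x') (hqs : q ≠ s)
    (h : (q.1 - x.1) * (s.2 - x.2) = (q.2 - x.2) * (s.1 - x.1))
    (h' : (q.1 - x'.1) * (s.2 - x'.2) = (q.2 - x'.2) * (s.1 - x'.1)) :
    q ∈ graphLine l ∧ s ∈ graphLine l := by
  have h0 := fst_ne_of_mem_graphLine hx hx' hne
  rw [mem_graphLine] at hx hx'
  have h1 : s.2 - q.2 = l.1 * (s.1 - q.1) := by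
    apply mul_left_cancel₀ h0
    rw [hx] at h
    rw [hx'] at h'
    linear_combination h - h'
  have h2 : s.1 - q.1 ≠ 0 := by
    intro h2
    rw [h2, mul_zero] at h1
    exact hqs (Prod.ext (by linarith) (by linarith))
  have h3 : q.2 = l.1 * q.1 + l.2 := by
    apply mul_left_cancel₀ h2
    have hs : s.2 = q.2 + l.1 * (s.1 - q.1) := by linarith
    rw [hs, hx] at h
    linear_combination -h
  refine ⟨h3, ?_⟩
  rw [mem_graphLine]
  linarith

/-- The points a new line must avoid so that adding it to `L` keeps general position. -/
def badPoints (L : Finset (Set (ℝ × ℝ))) : Set (ℝ × ℝ) :=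
  incSet L ∪ {x | ∃ q ∈ incSet L, ∃ s ∈ incSet L, ∃ ℓ ∈ L, q ≠ s ∧ ¬ (q ∈ ℓ ∧ s ∈ ℓ) ∧ x ∈ ℓ ∧
    (q.1 - x.1) * (s.2 - x.2) = (q.2 - x.2) * (s.1 - x.1)}

lemma incSet_finite {L : Finset (Set (ℝ × ℝ))} (h : PairwiseNonParallel L) :
    (incSet L).Finite := by
  have : incSet L = ⋃ ℓ₁ ∈ (L : Set (Set (ℝ × ℝ))), ⋃ ℓ₂ ∈ (L : Set (Set (ℝ × ℝ))),
      {p | ℓ₁ ≠ ℓ₂ ∧ p ∈ ℓ₁ ∧ p ∈ ℓ₂} := by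
    ext p
    simp only [incSet, Set.mem_ofPred_eq, Set.mem_iUnion, exists_prop, Finset.mem_coe]
  rw [this]
  refine L.finite_toSet.biUnion fun ℓ₁ h₁ => L.finite_toSet.biUnion fun ℓ₂ h₂ => ?_
  refine Set.Subsingleton.finite ?_
  rintro p ⟨hne, hp⟩ q ⟨-, hq⟩
  exact (h ℓ₁ h₁ ℓ₂ h₂ hne).unique hp hq

lemma badPoints_finite {L : Finset (Set (ℝ × ℝ))} (h : PairwiseNonParallel L)
    (hL : ∀ ℓ ∈ L, ∃ q, ℓ = graphLine q) : (badPoints L).Finite := by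
  have hI := incSet_finite h
  refine hI.union ?_
  have : {x : ℝ × ℝ | ∃ q ∈ incSet L, ∃ s ∈ incSet L, ∃ ℓ ∈ L, q ≠ s ∧ ¬ (q ∈ ℓ ∧ s ∈ ℓ) ∧ x ∈ ℓ ∧
      (q.1 - x.1) * (s.2 - x.2) = (q.2 - x.2) * (s.1 - x.1)} =
      ⋃ q ∈ incSet L, ⋃ s ∈ incSet L, ⋃ ℓ ∈ (L : Set (Set (ℝ × ℝ))),
        {x : ℝ × ℝ | q ≠ s ∧ ¬ (q ∈ ℓ ∧ s ∈ ℓ) ∧ x ∈ ℓ ∧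
          (q.1 - x.1) * (s.2 - x.2) = (q.2 - x.2) * (s.1 - x.1)} := by
    ext x
    simp only [Set.mem_ofPred_eq, Set.mem_iUnion, exists_prop, Finset.mem_coe]
  rw [this]
  refine hI.biUnion fun q _ => hI.biUnion fun s _ => L.finite_toSet.biUnion fun ℓ hℓ => ?_
  refine Set.Subsingleton.finite ?_
  rintro x ⟨hqs, hn, hx, hc⟩ x' ⟨-, -, hx', hc'⟩
  by_contra hne
  obtain ⟨l, rfl⟩ := hL ℓ hℓ
  exact hn (mem_graphLine_of_cross_of_cross hx hx' hne hqs hc hc')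

lemma mem_incSet_insert {L : Finset (Set (ℝ × ℝ))} {ℓ : Set (ℝ × ℝ)} {p : ℝ × ℝ}
    (h : p ∈ incSet (insert ℓ L)) : p ∈ incSet L ∨ p ∈ ℓ ∧ ∃ ℓ' ∈ L, p ∈ ℓ' := by
  obtain ⟨ℓ₁, h₁, ℓ₂, h₂, hne, hp₁, hp₂⟩ := h
  rw [Finset.mem_insert] at h₁ h₂
  rcases h₁ with rfl | h₁ <;> rcases h₂ with rfl | h₂
  · exact absurd rfl hne
  · exact Or.inr ⟨hp₁, ℓ₂, h₂, hp₂⟩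
  · exact Or.inr ⟨hp₂, ℓ₁, h₁, hp₁⟩
  · exact Or.inl ⟨ℓ₁, h₁, ℓ₂, h₂, hne, hp₁, hp₂⟩

lemma GenPos.insert_graphLine {L : Finset (Set (ℝ × ℝ))} (hG : GenPos L) {l : ℝ × ℝ}
    (hpar : ∀ ℓ ∈ L, NotParallel (graphLine l) ℓ) (hbad : ∀ x ∈ badPoints L, x ∉ graphLine l) :
    GenPos (insert (graphLine l) L) := by
  obtain ⟨hP, hC, hI⟩ := hG
  have hinc : ∀ x ∈ incSet L, x ∉ graphLine l := fun x hx => hbad x (Or.inl hx)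
  refine ⟨?_, ?_, ?_⟩
  · intro ℓ₁ h₁ ℓ₂ h₂ hne
    rw [Finset.mem_insert] at h₁ h₂
    rcases h₁ with rfl | h₁ <;> rcases h₂ with rfl | h₂
    · exact absurd rfl hne
    · exact hpar _ h₂
    · exact (hpar _ h₁).symm
    · exact hP _ h₁ _ h₂ hne
  · rintro ℓ₁ h₁ ℓ₂ h₂ ℓ₃ h₃ h₁₂ h₁₃ h₂₃ ⟨p, hp₁, hp₂, hp₃⟩
    rw [Finset.mem_insert] at h₁ h₂ h₃
    rcases h₁ with rfl | h₁
    · exact hinc p ⟨ℓ₂, h₂.resolve_left h₁₂.symm, ℓ₃, h₃.resolve_left h₁₃.symm, h₂₃, hp₂, hp₃⟩ hp₁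
    rcases h₂ with rfl | h₂
    · exact hinc p ⟨ℓ₁, h₁, ℓ₃, h₃.resolve_left h₂₃.symm, h₁₃, hp₁, hp₃⟩ hp₂
    rcases h₃ with rfl | h₃
    · exact hinc p ⟨ℓ₁, h₁, ℓ₂, h₂, h₁₂, hp₁, hp₂⟩ hp₃
    exact hC _ h₁ _ h₂ _ h₃ h₁₂ h₁₃ h₂₃ ⟨p, hp₁, hp₂, hp₃⟩
  · have one : ∀ {p q s : ℝ × ℝ} {ℓ : Set (ℝ × ℝ)}, p ∈ graphLine l → ℓ ∈ L → p ∈ ℓ →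
        q ∈ incSet L → s ∈ incSet L → q ≠ s →
        (q.1 - p.1) * (s.2 - p.2) = (q.2 - p.2) * (s.1 - p.1) → q ∈ ℓ ∧ s ∈ ℓ := by
      intro p q s ℓ hp hℓ hpℓ hq hs hqs hc
      by_contra hn
      exact hbad p (Or.inr ⟨q, hq, s, hs, ℓ, hℓ, hqs, hn, hpℓ, hc⟩) hp
    intro p q s hp hq hs hpq hps hqs hcol
    have hc := hcol.cross_eq
    rcases mem_incSet_insert hp with hp | ⟨hp, ℓ₁, h₁, hp₁⟩ <;>
      rcases mem_incSet_insert hq with hq | ⟨hq, ℓ₂, h₂, hq₂⟩ <;>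
      rcases mem_incSet_insert hs with hs | ⟨hs, ℓ₃, h₃, hs₃⟩
    · obtain ⟨ℓ, hℓ, h⟩ := hI p q s hp hq hs hpq hps hqs hcol
      exact ⟨ℓ, Finset.mem_insert_of_mem hℓ, h⟩
    · have := one hs h₃ hs₃ hp hq hpq (by linarith)
      exact ⟨ℓ₃, Finset.mem_insert_of_mem h₃, this.1, this.2, hs₃⟩
    · have := one hq h₂ hq₂ hp hs hps (by linarith)
      exact ⟨ℓ₂, Finset.mem_insert_of_mem h₂, this.1, hq₂, this.2⟩
    · exact absurd (mem_graphLine_of_cross hq hs hqs (by linarith)) (hinc p hp)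
    · have := one hp h₁ hp₁ hq hs hqs hc
      exact ⟨ℓ₁, Finset.mem_insert_of_mem h₁, hp₁, this⟩
    · exact absurd (mem_graphLine_of_cross hp hs hps (by linarith)) (hinc q hq)
    · exact absurd (mem_graphLine_of_cross hp hq hpq (by linarith)) (hinc s hs)
    · exact ⟨_, Finset.mem_insert_self _ _, hp, hq, hs⟩

lemma exists_dist_lt_notMem {F : Set ℝ} (hF : F.Finite) (x : ℝ) {δ : ℝ} (hδ : 0 < δ) :
    ∃ y, dist y x < δ ∧ y ∉ F := by
  obtain ⟨y, hy, hyF⟩ := (Set.Ioo_infinite (show x < x + δ by linarith)).exists_notMem_finite hF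
  refine ⟨y, ?_, hyF⟩
  rw [Real.dist_eq, abs_lt]
  constructor <;> linarith [hy.1, hy.2]

/-- Any finite family of non-vertical lines can be perturbed into general position. -/
lemma exists_genPos_perturbation {ι : Type*} (p₀ : ι → ℝ × ℝ) {δ : ℝ} (hδ : 0 < δ)
    (s : Finset ι) :
    ∃ p : ι → ℝ × ℝ, (∀ i, dist (p i) (p₀ i) < δ) ∧ GenPos (s.image fun i => graphLine (p i)) := by
  induction s using Finset.induction_on with
  | empty =>
    refine ⟨p₀, fun i => by simpa using hδ, ?_, ?_, ?_⟩
    · simp [PairwiseNonParallel]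
    · simp
    · simp [incSet]
  | insert i s hi ih =>
    obtain ⟨p, hp, hG⟩ := ih
    set L := s.image fun i => graphLine (p i) with hL
    have hfin : (badPoints L).Finite := by
      refine badPoints_finite hG.1 fun ℓ hℓ => ?_
      obtain ⟨j, -, rfl⟩ := Finset.mem_image.1 hℓ
      exact ⟨_, rfl⟩
    obtain ⟨m, hm, hmF⟩ := exists_dist_lt_notMem
      (s.finite_toSet.image fun j => (p j).1) (p₀ i).1 hδ
    obtain ⟨b, hb, hbF⟩ := exists_dist_lt_notMem
      (hfin.image fun x => x.2 - m * x.1) (p₀ i).2 hδ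
    refine ⟨Function.update p i (m, b), fun j => ?_, ?_⟩
    · rcases eq_or_ne j i with rfl | hj
      · rw [Function.update_self, Prod.dist_eq]
        exact max_lt hm hb
      · rw [Function.update_of_ne hj]
        exact hp j
    · have himg : ((insert i s).image fun j => graphLine (Function.update p i (m, b) j)) =
          insert (graphLine (m, b)) L := by
        rw [Finset.image_insert, Function.update_self, hL]
        congr 1
        refine Finset.image_congr fun j hj => ?_
        have hji : j ≠ i := fun h => hi (h ▸ hj)
        simp only [Function.update_of_ne hji]
      rw [himg]
      refine hG.insert_graphLine (fun ℓ hℓ => ?_) (fun x hx hxl => ?_)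
      · obtain ⟨j, hj, rfl⟩ := Finset.mem_image.1 hℓ
        exact notParallel_graphLine fun h => hmF ⟨j, hj, h.symm⟩
      · rw [mem_graphLine] at hxl
        exact hbF ⟨x, hx, by simp only at hxl ⊢; linarith⟩

/-- The slope-intercept pairs of a family of lines indexed by words, such that two lines whose
words first differ in position `k` meet close to the vertical line `x = k`. -/
noncomputable def digitLine {a r : ℕ} (ε : ℝ) (d : Fin r → Fin a) : ℝ × ℝ :=
  (∑ j : Fin r, ε ^ (j : ℕ) * (d j : ℕ), -∑ j : Fin r, ε ^ (j : ℕ) * (d j : ℕ) * (j : ℕ))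

lemma abs_tail_sum_le {r : ℕ} {ε C : ℝ} (hε : 0 ≤ ε) (hε1 : ε ≤ 1) (hC : 0 ≤ C) (k : Fin r)
    (D : Fin r → ℝ) (hD : ∀ j, |D j| ≤ C) (h0 : ∀ j, j ≤ k → D j = 0) :
    |∑ j : Fin r, ε ^ (j : ℕ) * D j| ≤ r * (ε ^ ((k : ℕ) + 1) * C) := by
  refine (Finset.abs_sum_le_sum_abs _ _).trans ?_
  calc ∑ j : Fin r, |ε ^ (j : ℕ) * D j| ≤ ∑ _j : Fin r, ε ^ ((k : ℕ) + 1) * C := by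
        refine Finset.sum_le_sum fun j _ => ?_
        rcases le_or_gt j k with hj | hj
        · rw [h0 j hj]
          simp only [mul_zero, abs_zero]
          positivity
        · rw [abs_mul, abs_of_nonneg (pow_nonneg hε _)]
          exact mul_le_mul (pow_le_pow_of_le_one hε hε1 hj) (hD j) (abs_nonneg _)
            (pow_nonneg hε _)
    _ = _ := by simp

lemma abs_digitLine_lt {a r : ℕ} (ha : 0 < a) (hr : 0 < r) {ε : ℝ}
    (hε : ε = 1 / (8 * a * r ^ 2)) {d e : Fin r → Fin a} {k : Fin r} (hk : d k ≠ e k)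
    (hlt : ∀ j < k, d j = e j) :
    |(digitLine ε d).2 - (digitLine ε e).2 + k * ((digitLine ε d).1 - (digitLine ε e).1)| <
      1 / 4 * |(digitLine ε d).1 - (digitLine ε e).1| := by
  have ha' : (1 : ℝ) ≤ a := by exact_mod_cast ha
  have hr' : (1 : ℝ) ≤ r := by exact_mod_cast hr
  have hε0 : 0 < ε := by rw [hε]; positivity
  have hεm : ε * (a * r ^ 2) = 1 / 8 := by rw [hε]; field_simp
  have har : (1 : ℝ) ≤ a * r ^ 2 := by nlinarith
  have hε1 : ε ≤ 1 := by nlinarith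
  set D : Fin r → ℝ := fun j => ((d j : ℕ) : ℝ) - ((e j : ℕ) : ℝ) with hDdef
  have hD0 : ∀ j < k, D j = 0 := fun j hj => by simp [hDdef, hlt j hj]
  have hDa : ∀ j, |D j| ≤ a := fun j => by
    have h1 : ((d j : ℕ) : ℝ) < a := by exact_mod_cast (d j).2
    have h2 : ((e j : ℕ) : ℝ) < a := by exact_mod_cast (e j).2
    have h3 : (0 : ℝ) ≤ (d j : ℕ) := Nat.cast_nonneg _
    have h4 : (0 : ℝ) ≤ (e j : ℕ) := Nat.cast_nonneg _
    rw [abs_le]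
    constructor <;> simp only [hDdef] <;> linarith
  have hDk : 1 ≤ |D k| := by
    have : ((d k : ℕ) : ℤ) - ((e k : ℕ) : ℤ) ≠ 0 := by
      intro h
      exact hk (Fin.ext (by omega))
    have := Int.one_le_abs this
    simp only [hDdef]
    exact_mod_cast this
  have hm : (digitLine ε d).1 - (digitLine ε e).1 =
      ε ^ (k : ℕ) * D k + ∑ j : Fin r, ε ^ (j : ℕ) * (if j = k then 0 else D j) := by
    have : ε ^ (k : ℕ) * D k = ∑ j : Fin r, ε ^ (j : ℕ) * (if j = k then D j else 0) := by
      simp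
    rw [this, ← Finset.sum_add_distrib]
    simp only [digitLine]
    rw [← Finset.sum_sub_distrib]
    refine Finset.sum_congr rfl fun j _ => ?_
    split_ifs <;> simp only [hDdef] <;> ring
  have hb : (digitLine ε d).2 - (digitLine ε e).2 +
      k * ((digitLine ε d).1 - (digitLine ε e).1) =
      ∑ j : Fin r, ε ^ (j : ℕ) * (D j * (((k : ℕ) : ℝ) - ((j : ℕ) : ℝ))) := by
    simp only [digitLine]
    rw [← Finset.sum_sub_distrib, Finset.mul_sum, neg_sub_neg, ← Finset.sum_sub_distrib,
      ← Finset.sum_add_distrib]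
    refine Finset.sum_congr rfl fun j _ => ?_
    simp only [hDdef]
    ring
  have h1 := abs_tail_sum_le hε0.le hε1 (Nat.cast_nonneg a) k
    (fun j => if j = k then 0 else D j)
    (fun j => by
      split_ifs
      · simp
      · exact hDa j)
    (fun j hj => by
      split_ifs with h
      · rfl
      · exact hD0 j (lt_of_le_of_ne hj h))
  have h2 := abs_tail_sum_le hε0.le hε1 (C := a * r) (by positivity) k
    (fun j => D j * (((k : ℕ) : ℝ) - ((j : ℕ) : ℝ)))
    (fun j => by
      rw [abs_mul]
      refine mul_le_mul (hDa j) ?_ (abs_nonneg _) (by positivity)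
      have h1 : ((k : ℕ) : ℝ) < r := by exact_mod_cast k.2
      have h2 : ((j : ℕ) : ℝ) < r := by exact_mod_cast j.2
      have h3 : (0 : ℝ) ≤ (k : ℕ) := Nat.cast_nonneg _
      have h4 : (0 : ℝ) ≤ (j : ℕ) := Nat.cast_nonneg _
      rw [abs_le]
      constructor <;> linarith)
    (fun j hj => by
      rcases hj.lt_or_eq with hj | rfl
      · simp [hD0 j hj]
      · simp)
  rw [← hb] at h2
  have hpow : 0 < ε ^ (k : ℕ) := pow_pos hε0 _
  have h3 : (r : ℝ) * (ε ^ ((k : ℕ) + 1) * (a * r)) = ε ^ (k : ℕ) / 8 := by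
    rw [pow_succ]
    linear_combination ε ^ (k : ℕ) * hεm
  have h4 : (r : ℝ) * (ε ^ ((k : ℕ) + 1) * a) ≤ ε ^ (k : ℕ) / 8 := by
    rw [← h3]
    gcongr
    nlinarith
  have h5 : ε ^ (k : ℕ) ≤ |ε ^ (k : ℕ) * D k| := by
    rw [abs_mul, abs_of_pos hpow]
    nlinarith
  have h6 : |ε ^ (k : ℕ) * D k| - |∑ j : Fin r, ε ^ (j : ℕ) * (if j = k then 0 else D j)| ≤
      |(digitLine ε d).1 - (digitLine ε e).1| := by
    rw [hm]
    have := abs_sub_abs_le_abs_sub (ε ^ (k : ℕ) * D k)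
      (-∑ j : Fin r, ε ^ (j : ℕ) * (if j = k then 0 else D j))
    rwa [abs_neg, sub_neg_eq_add] at this
  linarith

lemma exists_first_ne {r : ℕ} {α : Type*} {d e : Fin r → α} (h : d ≠ e) :
    ∃ k, d k ≠ e k ∧ ∀ j < k, d j = e j := by
  obtain ⟨k, hk⟩ := Function.ne_iff.1 h
  obtain ⟨k, hk, hmin⟩ := WellFounded.has_min (wellFounded_lt (α := Fin r))
    {k | d k ≠ e k} ⟨k, hk⟩
  exact ⟨k, hk, fun j hj => by_contra fun hn => hmin j hn hj⟩

lemma exists_genPos_family (a r : ℕ) (ha : 0 < a) (hr : 0 < r) :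
    ∃ p : (Fin r → Fin a) → ℝ × ℝ, GenPos (Finset.univ.image fun d => graphLine (p d)) ∧
      ∀ (d e : Fin r → Fin a) (k : Fin r), d k ≠ e k → (∀ j < k, d j = e j) →
        |(p d).2 - (p e).2 + k * ((p d).1 - (p e).1)| < 1 / 4 * |(p d).1 - (p e).1| := by
  let U : Set ((Fin r → Fin a) → ℝ × ℝ) :=
    ⋂ d, ⋂ e, ⋂ k : Fin r, ⋂ _ : d k ≠ e k, ⋂ _ : ∀ j < k, d j = e j,
      {p | |(p d).2 - (p e).2 + k * ((p d).1 - (p e).1)| < 1 / 4 * |(p d).1 - (p e).1|}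
  have hU : IsOpen U := by
    refine isOpen_iInter_of_finite fun d => isOpen_iInter_of_finite fun e =>
      isOpen_iInter_of_finite fun k => isOpen_iInter_of_finite fun _ =>
      isOpen_iInter_of_finite fun _ => isOpen_lt ?_ ?_ <;> fun_prop
  have h0 : (digitLine (1 / (8 * a * r ^ 2)) : (Fin r → Fin a) → ℝ × ℝ) ∈ U := by
    simp only [U, Set.mem_iInter]
    intro d e k hk hlt
    exact abs_digitLine_lt ha hr rfl hk hlt
  obtain ⟨δ, hδ, hball⟩ := Metric.isOpen_iff.1 hU _ h0
  obtain ⟨p, hp, hG⟩ := exists_genPos_perturbation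
    (digitLine (1 / (8 * a * r ^ 2)) : (Fin r → Fin a) → ℝ × ℝ) hδ Finset.univ
  refine ⟨p, hG, ?_⟩
  have := hball (Metric.mem_ball.2 ((dist_pi_lt_iff hδ).2 hp))
  simpa only [U, Set.mem_iInter, Set.mem_ofPred_eq] using this

lemma IsVerticalStrip.mem_of_between {S : Set (ℝ × ℝ)} (hS : IsVerticalStrip S) {u v w : ℝ × ℝ}
    (hu : u ∈ S) (hv : v ∈ S) (h1 : u.1 ≤ w.1) (h2 : w.1 ≤ v.1) : w ∈ S := by
  obtain ⟨s, t, rfl⟩ := hS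
  exact ⟨hu.1.trans (by exact_mod_cast h1), le_trans (by exact_mod_cast h2) hv.2⟩

/-- The open vertical strip separating the clusters around `x = k` and `x = k + 1`. -/
def gapStrip (k : ℕ) : Set (ℝ × ℝ) := {w | (k : ℝ) + 1 / 4 < w.1 ∧ w.1 < k + 3 / 4}

lemma isOpen_gapStrip (k : ℕ) : IsOpen (gapStrip k) :=
  (isOpen_lt continuous_const continuous_fst).inter (isOpen_lt continuous_fst continuous_const)

lemma gapStrip_subset {S : Set (ℝ × ℝ)} (hS : IsVerticalStrip S) {k k' : ℕ} (hk : k < k')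
    {u v : ℝ × ℝ} (hu : u ∈ S) (hv : v ∈ S) (huk : |u.1 - k| < 1 / 4) (hvk : |v.1 - k'| < 1 / 4) :
    gapStrip k ⊆ S := by
  rintro w ⟨h1, h2⟩
  rw [abs_lt] at huk hvk
  have : (k : ℝ) + 1 ≤ k' := by exact_mod_cast hk
  exact hS.mem_of_between hu hv (by linarith) (by linarith)

/-- **Upper bound for vertical strips.** For positive integers `a`, `r` there is a set `A`
of `a^r` lines in general position such that every partition of the plane into `r` closed
vertical strips has a strip `S_i` with `μ_A(S_i) ≤ a`. -/
theorem vertical_strip_bound (a r : ℕ) (ha : 0 < a) (hr : 0 < r) :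
    ∃ A : Finset (Set (ℝ × ℝ)), (∀ ℓ ∈ A, IsLine ℓ) ∧ A.card = a ^ r ∧ GenPos A ∧
      ∀ S : Fin r → Set (ℝ × ℝ),
        (∀ i, IsVerticalStrip (S i)) →
        (⋃ i, S i) = Set.univ →
        (Pairwise fun i j => interior (S i) ∩ interior (S j) = ∅) →
        ∃ i : Fin r, mu A (S i) ≤ a := by
  obtain ⟨p, hG, hp⟩ := exists_genPos_family a r ha hr
  have hinj : Function.Injective fun d => graphLine (p d) := by
    refine graphLine_injective.comp fun d e hde => ?_
    by_contra hne
    obtain ⟨k, hk, hlt⟩ := exists_first_ne hne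
    have := hp d e k hk hlt
    simp [hde] at this
  refine ⟨Finset.univ.image fun d => graphLine (p d), ?_, ?_, hG, ?_⟩
  · intro ℓ hℓ
    obtain ⟨d, -, rfl⟩ := Finset.mem_image.1 hℓ
    exact isLine_graphLine _
  · rw [Finset.card_image_of_injective _ hinj]
    simp
  intro S hS _ hdisj
  by_contra! hmu
  have hgap : ∀ i, ∃ k : Fin (r - 1), gapStrip k ⊆ S i := by
    intro i
    obtain ⟨A', hA', hcard⟩ := Finset.lt_sup_iff.1 (hmu i)
    rw [Finset.mem_filter, Finset.mem_powerset] at hA'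
    obtain ⟨hsub, hinc⟩ := hA'
    obtain ⟨T, -, rfl⟩ := Finset.subset_image_iff.1 hsub
    rw [Finset.card_image_of_injective _ hinj] at hcard
    have hmeet : ∀ d ∈ T, ∀ e ∈ T, ∀ k : Fin r, d k ≠ e k → (∀ j < k, d j = e j) →
        ∃ u ∈ S i, |u.1 - (k : ℕ)| < 1 / 4 := by
      intro d hd e he k hk hlt
      have hne : d ≠ e := fun h => hk (h ▸ rfl)
      have hb := hp d e k hk hlt
      obtain ⟨u, ⟨hu1, hu2⟩, -⟩ := hG.1 _ (Finset.mem_image_of_mem _ (Finset.mem_univ d)) _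
        (Finset.mem_image_of_mem _ (Finset.mem_univ e)) (hinj.ne hne)
      refine ⟨u, hinc ⟨_, Finset.mem_image_of_mem _ hd, _, Finset.mem_image_of_mem _ he,
        hinj.ne hne, hu1, hu2⟩, ?_⟩
      simp only [mem_graphLine] at hu1 hu2
      have hpos : 0 < |(p d).1 - (p e).1| := by
        by_contra h
        linarith [abs_nonneg ((p d).2 - (p e).2 + k * ((p d).1 - (p e).1))]
      have heq : (p d).2 - (p e).2 + k * ((p d).1 - (p e).1) =
          -((u.1 - (k : ℕ)) * ((p d).1 - (p e).1)) := by
        linear_combination hu2 - hu1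
      rw [heq, abs_neg, abs_mul] at hb
      exact lt_of_mul_lt_mul_right hb hpos.le
    obtain ⟨d, hd, e, he, hde⟩ := Finset.one_lt_card.1 (lt_of_le_of_lt ha hcard)
    obtain ⟨k, hk, hlt⟩ := exists_first_ne hde
    obtain ⟨d', hd', e', he', hne', heq'⟩ := Finset.exists_ne_map_eq_of_card_lt_of_maps_to
      (s := T) (t := Finset.univ) (f := fun d => d k) (by simpa using hcard) (fun _ _ => by simp)
    obtain ⟨k', hk', hlt'⟩ := exists_first_ne hne'
    obtain ⟨u, hu, huk⟩ := hmeet d hd e he k hk hlt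
    obtain ⟨v, hv, hvk⟩ := hmeet d' hd' e' he' k' hk' hlt'
    have hkk : k ≠ k' := by
      rintro rfl
      exact hk' heq'
    have h1 := k.2
    have h2 := k'.2
    rcases lt_or_gt_of_ne hkk with h | h
    · exact ⟨⟨k, by omega⟩, gapStrip_subset (hS i) h hu hv huk hvk⟩
    · exact ⟨⟨k', by omega⟩, gapStrip_subset (hS i) h hv hu hvk huk⟩
  choose g hg using hgap
  obtain ⟨i, j, hij, hgij⟩ := Fintype.exists_ne_map_eq_of_card_lt g (by simpa using hr)
  have hw : (((g i : ℕ) : ℝ) + 1 / 2, (0 : ℝ)) ∈ gapStrip (g i) := by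
    constructor <;> simp only <;> linarith
  have h1 := interior_maximal (hg i) (isOpen_gapStrip _) hw
  rw [hgij] at hw h1
  have h2 := interior_maximal (hg j) (isOpen_gapStrip _) hw
  exact (Set.eq_empty_iff_forall_notMem.1 (hdisj hij) _) ⟨h1, h2⟩
end
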